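/- Stein's lemma for classical-quantum channels: let N, M : X → B be classical-quantum channels determined by finite families of states {ν_B^x}_{x∈X} and {μ_B^x}_{x∈X}. Then the optimal asymptotic type II error exponent under adaptive strategies equals the best single-letter relative entropy: lim_{ε→0⁺} lim_{n→∞} ζ_n(ε, N, M) = max_{x∈X} D(ν_B^x ‖ μ_B^x), where in particular both limits exist. -/

import Mathlib

open scoped BigOperators ComplexOrder

noncomputable section

attribute [local instance] Classical.propDecidable

/-- A density matrix (quantum state): positive semidefinite with unit trace. -/
def IsDensity {ι : Type} [Fintype ι] (ρ : Matrix ι ι ℂ) : Prop :=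
  ρ.PosSemidef ∧ ρ.trace = 1

/-- The map `id_R ⊗ Φ` (for linear `Φ`), defined blockwise. -/
def idTensor {R ι κ : Type} (Φ : Matrix ι ι ℂ → Matrix κ κ ℂ)
    (X : Matrix (R × ι) (R × ι) ℂ) : Matrix (R × κ) (R × κ) ℂ :=
  fun p q => Φ (fun a b => X (p.1, a) (q.1, b)) p.2 q.2

/-- The map `Φ ⊗ id_E` (for linear `Φ`), defined blockwise. -/
def tensorId {ι κ E : Type} (Φ : Matrix ι ι ℂ → Matrix κ κ ℂ)
    (X : Matrix (ι × E) (ι × E) ℂ) : Matrix (κ × E) (κ × E) ℂ :=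
  fun p q => Φ (fun a b => X (a, p.2) (b, q.2)) p.1 q.1

/-- A quantum channel: linear, trace preserving, and completely positive. -/
structure IsChannel {ι κ : Type} [Fintype ι] [Fintype κ]
    (Φ : Matrix ι ι ℂ → Matrix κ κ ℂ) : Prop where
  linear : IsLinearMap ℂ Φ
  tracePres : ∀ X, (Φ X).trace = X.trace
  compPos : ∀ (k : ℕ) (X : Matrix (Fin k × ι) (Fin k × ι) ℂ),
      X.PosSemidef → (idTensor Φ X).PosSemidef

/-- A family of divergences, one for every finite dimension. -/
abbrev DivFam : Type 1 :=
  ∀ (ι : Type) [Fintype ι] [DecidableEq ι], Matrix ι ι ℂ → Matrix ι ι ℂ → EReal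

/-- Data processing: a generalized divergence does not increase under channels. -/
def DivDataProcessing (D : DivFam) : Prop :=
  ∀ (ι κ : Type) [Fintype ι] [DecidableEq ι] [Fintype κ] [DecidableEq κ]
    (Φ : Matrix ι ι ℂ → Matrix κ κ ℂ), IsChannel Φ →
    ∀ ρ σ : Matrix ι ι ℂ, IsDensity ρ → IsDensity σ →
      D κ (Φ ρ) (Φ σ) ≤ D ι ρ σ

/-- Faithfulness: `D(ρ‖ρ) ≤ 0` for every state `ρ`. -/
def DivFaithful (D : DivFam) : Prop :=
  ∀ (ι : Type) [Fintype ι] [DecidableEq ι] (ρ : Matrix ι ι ℂ),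
    IsDensity ρ → D ι ρ ρ ≤ 0

/-- Strong faithfulness: `D(ρ‖σ) = 0` iff `ρ = σ`. -/
def DivStronglyFaithful (D : DivFam) : Prop :=
  ∀ (ι : Type) [Fintype ι] [DecidableEq ι] (ρ σ : Matrix ι ι ℂ),
    IsDensity ρ → IsDensity σ → (D ι ρ σ = 0 ↔ ρ = σ)

/-- The generalized channel divergence `D(N‖M)`. -/
def channelDiv (D : DivFam) {ι κ : Type} [Fintype ι] [DecidableEq ι] [Fintype κ] [DecidableEq κ]
    (N M : Matrix ι ι ℂ → Matrix κ κ ℂ) : EReal :=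
  ⨆ (R : ℕ) (ρ : Matrix (Fin R × ι) (Fin R × ι) ℂ) (_ : IsDensity ρ),
    D (Fin R × κ) (idTensor N ρ) (idTensor M ρ)

/-- The amortized channel divergence `D^𝒜(N‖M)`. -/
def amortizedDiv (D : DivFam) {ι κ : Type} [Fintype ι] [DecidableEq ι] [Fintype κ] [DecidableEq κ]
    (N M : Matrix ι ι ℂ → Matrix κ κ ℂ) : EReal :=
  ⨆ (R : ℕ) (ρ : Matrix (Fin R × ι) (Fin R × ι) ℂ) (σ : Matrix (Fin R × ι) (Fin R × ι) ℂ)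
    (_ : IsDensity ρ) (_ : IsDensity σ),
      D (Fin R × κ) (idTensor N ρ) (idTensor M σ) - D (Fin R × ι) ρ σ

/-- Apply a real function to a Hermitian matrix via the spectral decomposition. -/
def hermFun {ι : Type} [Fintype ι] [DecidableEq ι] (f : ℝ → ℝ) (A : Matrix ι ι ℂ) :
    Matrix ι ι ℂ :=
  if hA : A.IsHermitian then
    (hA.eigenvectorUnitary : Matrix ι ι ℂ) *
      Matrix.diagonal (fun i => (f (hA.eigenvalues i) : ℂ)) *
      star (hA.eigenvectorUnitary : Matrix ι ι ℂ)
  else 0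

/-- Real matrix power via spectral calculus, with the generalized-inverse convention `0 ↦ 0`. -/
def matPow {ι : Type} [Fintype ι] [DecidableEq ι] (A : Matrix ι ι ℂ) (r : ℝ) : Matrix ι ι ℂ :=
  hermFun (fun x => if x = 0 then 0 else Real.rpow x r) A

/-- Matrix base-2 logarithm via spectral calculus, taken on the support. -/
def matLog2 {ι : Type} [Fintype ι] [DecidableEq ι] (A : Matrix ι ι ℂ) : Matrix ι ι ℂ :=
  hermFun (fun x => if x = 0 then 0 else Real.logb 2 x) A

/-- The projection onto the support of a Hermitian matrix. -/
def suppProj {ι : Type} [Fintype ι] [DecidableEq ι] (A : Matrix ι ι ℂ) : Matrix ι ι ℂ :=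
  hermFun (fun x => if x = 0 then 0 else 1) A

/-- `supp ρ ⊆ supp σ`, expressed (for Hermitian matrices) as kernel containment
`ker σ ⊆ ker ρ`. -/
def suppLE {ι : Type} [Fintype ι] (ρ σ : Matrix ι ι ℂ) : Prop :=
  ∀ v : ι → ℂ, σ.mulVec v = 0 → ρ.mulVec v = 0

/-- The quantum relative entropy `D(ρ‖σ) = Tr[ρ(log₂ρ − log₂σ)]`,
`+∞` if the support condition fails. -/
def relEnt {ι : Type} [Fintype ι] [DecidableEq ι] (ρ σ : Matrix ι ι ℂ) : EReal :=
  if suppLE ρ σ then (((ρ * (matLog2 ρ - matLog2 σ)).trace).re : EReal) else ⊤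

/-- `−log₂ x` as an extended real, with `−log₂ 0 = +∞`. -/
def negLog2 (x : ℝ) : EReal :=
  if x ≤ 0 then ⊤ else ((-Real.logb 2 x : ℝ) : EReal)

/-- The max-relative entropy `D_max(ρ‖σ) = inf{λ : ρ ≤ 2^λ σ}` (Loewner order). -/
def Dmax {ι : Type} [Fintype ι] (ρ σ : Matrix ι ι ℂ) : EReal :=
  ⨅ (l : ℝ) (_ : (((2 : ℝ) ^ l) • σ - ρ).PosSemidef), (l : EReal)

/-- The sandwiched Rényi divergence `D̃_α`. -/
def sandRenyi {ι : Type} [Fintype ι] [DecidableEq ι] (α : ℝ) (ρ σ : Matrix ι ι ℂ) : EReal :=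
  if α = 1 then relEnt ρ σ
  else if 1 < α ∧ ¬ suppLE ρ σ then ⊤
  else if α < 1 ∧ (ρ * σ).trace = 0 then ⊤
  else ((((α - 1)⁻¹ *
      Real.logb 2
        (((matPow (matPow σ ((1 - α) / (2 * α)) * ρ * matPow σ ((1 - α) / (2 * α))) α).trace).re)) :
        ℝ) : EReal)

/-- The Petz–Rényi divergence `D_α`. -/
def petzRenyi {ι : Type} [Fintype ι] [DecidableEq ι] (α : ℝ) (ρ σ : Matrix ι ι ℂ) : EReal :=
  if α = 0 then negLog2 (((suppProj ρ * σ).trace).re)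
  else if α = 1 then relEnt ρ σ
  else if 1 < α ∧ ¬ suppLE ρ σ then ⊤
  else if α < 1 ∧ (ρ * σ).trace = 0 then ⊤
  else ((((α - 1)⁻¹ * Real.logb 2 (((matPow ρ α * matPow σ (1 - α)).trace).re)) : ℝ) : EReal)

/-- The trace norm `‖X‖₁ = Tr √(XᴴX)`. -/
def traceNorm {ι : Type} [Fintype ι] [DecidableEq ι] (X : Matrix ι ι ℂ) : ℝ :=
  ((matPow (X.conjTranspose * X) (1/2 : ℝ)).trace).re

/-- The fidelity `F(ρ,σ) = ‖√ρ√σ‖₁²`. -/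
def matFidelity {ι : Type} [Fintype ι] [DecidableEq ι] (ρ σ : Matrix ι ι ℂ) : ℝ :=
  (traceNorm (matPow ρ (1/2 : ℝ) * matPow σ (1/2 : ℝ))) ^ 2

def relEntFam : DivFam := fun _ _ _ ρ σ => relEnt ρ σ
def DmaxFam : DivFam := fun _ _ _ ρ σ => Dmax ρ σ
def sandFam (α : ℝ) : DivFam := fun _ _ _ ρ σ => sandRenyi α ρ σ
def petzFam (α : ℝ) : DivFam := fun _ _ _ ρ σ => petzRenyi α ρ σ
/-- `D̃_{1/2}(ρ‖σ) = −log₂ F(ρ,σ)` as a divergence family. -/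
def fidDivFam : DivFam := fun _ _ _ ρ σ => negLog2 (matFidelity ρ σ)

/-- The classical-quantum state `Σ_x p(x) |x⟩⟨x| ⊗ ρ^x`. -/
def cqState {X ι : Type} [DecidableEq X] (p : X → ℝ) (ρ : X → Matrix ι ι ℂ) :
    Matrix (X × ι) (X × ι) ℂ :=
  fun a b => if a.1 = b.1 then (p a.1 : ℂ) * ρ a.1 a.2 b.2 else 0

/-- The direct-sum property of a generalized divergence on classical-quantum states. -/
def DivDirectSum (D : DivFam) : Prop :=
  ∀ (X ι : Type) [Fintype X] [DecidableEq X] [Fintype ι] [DecidableEq ι]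
    (p : X → ℝ), (∀ x, 0 ≤ p x) → (∑ x, p x = 1) →
    ∀ (ρ σ : X → Matrix ι ι ℂ), (∀ x, IsDensity (ρ x)) → (∀ x, IsDensity (σ x)) →
      D (X × ι) (cqState p ρ) (cqState p σ) = ∑ x, (p x : EReal) * D ι (ρ x) (σ x)

/-- The Kronecker (tensor) product of square matrices. -/
def mkron {ι E : Type} (A : Matrix ι ι ℂ) (B : Matrix E E ℂ) : Matrix (ι × E) (ι × E) ℂ :=
  fun p q => A p.1 q.1 * B p.2 q.2

/-- Sub-additivity of a divergence with respect to tensor-product states. -/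
def DivSubAdditive (D : DivFam) : Prop :=
  ∀ (ι E : Type) [Fintype ι] [DecidableEq ι] [Fintype E] [DecidableEq E]
    (ρ σ : Matrix ι ι ℂ) (ω τ : Matrix E E ℂ),
    IsDensity ρ → IsDensity σ → IsDensity ω → IsDensity τ →
      D (ι × E) (mkron ρ ω) (mkron σ τ) ≤ D ι ρ σ + D E ω τ

/-- The classical-quantum channel `ρ ↦ Σ_x ⟨x|ρ|x⟩ ν^x`. -/
def cqChannel {X κ : Type} [Fintype X] [Fintype κ] (ν : X → Matrix κ κ ℂ) :
    Matrix X X ℂ → Matrix κ κ ℂ :=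
  fun ρ => ∑ x, ρ x x • ν x

/-- The maximally entangled state of Schmidt rank `|ι|` on `ι × ι`. -/
def maxEnt (ι : Type) [Fintype ι] [DecidableEq ι] : Matrix (ι × ι) (ι × ι) ℂ :=
  fun p q => if p.1 = p.2 ∧ q.1 = q.2 then ((Fintype.card ι : ℂ))⁻¹ else 0

/-- An `(m+1)`-round adaptive channel discrimination protocol: registers `R_0, …, R_m`,
a shared initial state, adaptive channels between channel uses, and a final measurement. -/
structure Protocol (ι κ : Type) [Fintype ι] [DecidableEq ι] [Fintype κ] [DecidableEq κ]
    (m : ℕ) where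
  r : ℕ → ℕ
  init : Matrix (Fin (r 0) × ι) (Fin (r 0) × ι) ℂ
  init_density : IsDensity init
  adapt : ∀ i : ℕ, Matrix (Fin (r i) × κ) (Fin (r i) × κ) ℂ →
      Matrix (Fin (r (i + 1)) × ι) (Fin (r (i + 1)) × ι) ℂ
  adapt_channel : ∀ i, i < m → IsChannel (adapt i)
  meas : Matrix (Fin (r m) × κ) (Fin (r m) × κ) ℂ
  meas_psd : meas.PosSemidef
  meas_le_one : ((1 : Matrix (Fin (r m) × κ) (Fin (r m) × κ) ℂ) - meas).PosSemidef

namespace Protocol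

variable {ι κ : Type} [Fintype ι] [DecidableEq ι] [Fintype κ] [DecidableEq κ] {m : ℕ}

/-- The state on `R_i ⊗ A` just before the `(i+1)`-st channel use, when the channel is `Ch`. -/
def evolve (P : Protocol ι κ m) (Ch : Matrix ι ι ℂ → Matrix κ κ ℂ) :
    (i : ℕ) → Matrix (Fin (P.r i) × ι) (Fin (P.r i) × ι) ℂ
  | 0 => P.init
  | (i + 1) => P.adapt i (idTensor Ch (P.evolve Ch i))

/-- The final state on `R_m ⊗ B` after all `m + 1` channel uses. -/
def final (P : Protocol ι κ m) (Ch : Matrix ι ι ℂ → Matrix κ κ ℂ) :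
    Matrix (Fin (P.r m) × κ) (Fin (P.r m) × κ) ℂ :=
  idTensor Ch (P.evolve Ch m)

/-- The probability of accepting (deciding for the null hypothesis). -/
def acceptProb (P : Protocol ι κ m) (Ch : Matrix ι ι ℂ → Matrix κ κ ℂ) : ℝ :=
  ((P.meas * P.final Ch).trace).re

/-- The type I error probability `Tr[(I − Q) ρ'⁽ⁿ⁾]`. -/
def typeI (P : Protocol ι κ m) (N : Matrix ι ι ℂ → Matrix κ κ ℂ) : ℝ :=
  ((((1 : Matrix (Fin (P.r m) × κ) (Fin (P.r m) × κ) ℂ) - P.meas) * P.final N).trace).re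

/-- The type II error probability `Tr[Q τ'⁽ⁿ⁾]`. -/
def typeII (P : Protocol ι κ m) (M : Matrix ι ι ℂ → Matrix κ κ ℂ) : ℝ :=
  ((P.meas * P.final M).trace).re

end Protocol

/-- The binary (classical) state `diag(p, 1−p)`. -/
def binState (p : ℝ) : Matrix (Fin 2) (Fin 2) ℂ :=
  Matrix.diagonal (fun i => if i = 0 then (p : ℂ) else ((1 - p : ℝ) : ℂ))

/-- The binary entropy `h₂(ε)`. -/
def h2 (ε : ℝ) : ℝ := -(ε * Real.logb 2 ε) - (1 - ε) * Real.logb 2 (1 - ε)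

/-- `ζ_n(ε, N, M)` with `n = m + 1`: the optimal type II error exponent among all
`(m+1)`-round adaptive protocols with type I error at most `ε`. -/
def steinExp {ι κ : Type} [Fintype ι] [DecidableEq ι] [Fintype κ] [DecidableEq κ]
    (N M : Matrix ι ι ℂ → Matrix κ κ ℂ) (m : ℕ) (ε : ℝ) : EReal :=
  ⨆ (P : Protocol ι κ m) (_ : P.typeI N ≤ ε),
    (((m + 1 : ℝ))⁻¹ : EReal) * negLog2 (P.typeII M)

/-- Partial trace over the (left) reference system. -/
def ptraceLeft {R ι : Type} [Fintype R] (ψ : Matrix (R × ι) (R × ι) ℂ) : Matrix ι ι ℂ :=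
  fun a b => ∑ r, ψ (r, a) (r, b)

/-- The energy-constrained generalized channel divergence. -/
def eChannelDiv (D : DivFam) {ι κ : Type} [Fintype ι] [DecidableEq ι] [Fintype κ] [DecidableEq κ]
    (H : Matrix ι ι ℂ) (E : ℝ) (N M : Matrix ι ι ℂ → Matrix κ κ ℂ) : EReal :=
  ⨆ (R : ℕ) (ψ : Matrix (Fin R × ι) (Fin R × ι) ℂ) (_ : IsDensity ψ)
    (_ : ((H * ptraceLeft ψ).trace).re ≤ E),
      D (Fin R × κ) (idTensor N ψ) (idTensor M ψ)

/-- The energy-constrained amortized channel divergence. -/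
def eAmortizedDiv (D : DivFam) {ι κ : Type} [Fintype ι] [DecidableEq ι] [Fintype κ] [DecidableEq κ]
    (H : Matrix ι ι ℂ) (E : ℝ) (N M : Matrix ι ι ℂ → Matrix κ κ ℂ) : EReal :=
  ⨆ (R : ℕ) (ρ : Matrix (Fin R × ι) (Fin R × ι) ℂ) (σ : Matrix (Fin R × ι) (Fin R × ι) ℂ)
    (_ : IsDensity ρ) (_ : IsDensity σ)
    (_ : ((H * ptraceLeft ρ).trace).re ≤ E) (_ : ((H * ptraceLeft σ).trace).re ≤ E),
      D (Fin R × κ) (idTensor N ρ) (idTensor M σ) - D (Fin R × ι) ρ σ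

/-- `sup_α(ρ/σ)`: supremum of `Tr[Λρ]/Tr[Λσ]` over Hermitian `Λ` with `α⁻¹ I ≤ Λ ≤ I`. -/
def hilbertSup {ι : Type} [Fintype ι] [DecidableEq ι] (α : ℝ) (ρ σ : Matrix ι ι ℂ) : ℝ :=
  sSup { t : ℝ | ∃ Λ : Matrix ι ι ℂ, Λ.IsHermitian ∧
    (Λ - (α⁻¹ : ℝ) • (1 : Matrix ι ι ℂ)).PosSemidef ∧
    ((1 : Matrix ι ι ℂ) - Λ).PosSemidef ∧
    t = ((Λ * ρ).trace).re / ((Λ * σ).trace).re }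

/-- The Hilbert `α`-divergence `H_α(ρ‖σ)`, with `H₁(ρ‖σ) = ‖ρ−σ‖₁ / (2 ln 2)`. -/
def hilbertDiv {ι : Type} [Fintype ι] [DecidableEq ι] (α : ℝ) (ρ σ : Matrix ι ι ℂ) : ℝ :=
  if α = 1 then (2 * Real.log 2)⁻¹ * traceNorm (ρ - σ)
  else (α / (α - 1)) * Real.logb 2 (hilbertSup α ρ σ)


section MatrixPreliminaries

open Matrix

lemma Matrix.PosSemidef.re_trace_nonneg {ι : Type} [Fintype ι] {A : Matrix ι ι ℂ}
    (hA : A.PosSemidef) : 0 ≤ A.trace.re :=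
  (Complex.nonneg_iff.mp hA.trace_nonneg).1

open scoped MatrixOrder in
lemma Matrix.PosSemidef.re_trace_mul_nonneg {ι : Type} [Fintype ι] {A B : Matrix ι ι ℂ}
    (hA : A.PosSemidef) (hB : B.PosSemidef) : 0 ≤ (A * B).trace.re := by
  classical
  obtain ⟨C, rfl⟩ := CStarAlgebra.nonneg_iff_eq_star_mul_self.mp hA.nonneg
  rw [star_eq_conjTranspose, Matrix.mul_assoc, trace_mul_comm]
  exact (hB.mul_mul_conjTranspose_same C).re_trace_nonneg

open scoped MatrixOrder in
lemma re_trace_mul_le_of_le {ι : Type} [Fintype ι] {A B C : Matrix ι ι ℂ}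
    (hA : A.PosSemidef) (h : B ≤ C) : (A * B).trace.re ≤ (A * C).trace.re := by
  have := hA.re_trace_mul_nonneg (Matrix.le_iff.mp h)
  rw [Matrix.mul_sub, trace_sub, Complex.sub_re] at this
  linarith

lemma re_trace_mul_mul_le {ι : Type} [Fintype ι] [DecidableEq ι] {Q S : Matrix ι ι ℂ}
    (hQ : Q.PosSemidef) (hQ1 : (1 - Q).PosSemidef) (hS : S.PosSemidef) :
    (Q * S * Q).trace.re ≤ (Q * S).trace.re := by
  have h1 : (Q - Q * Q).PosSemidef := by
    have e : Q - Q * Q = Q * (1 - Q) * Qᴴ + (1 - Q) * Q * (1 - Q)ᴴ := by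
      rw [hQ.isHermitian.eq, hQ1.isHermitian.eq]
      noncomm_ring
    rw [e]
    exact (hQ1.mul_mul_conjTranspose_same Q).add (hQ.mul_mul_conjTranspose_same (1 - Q))
  have h2 := h1.re_trace_mul_nonneg hS
  rw [Matrix.sub_mul, trace_sub, Complex.sub_re] at h2
  rw [trace_mul_comm, ← Matrix.mul_assoc]
  linarith

open scoped MatrixOrder Matrix.Norms.L2Operator in
/-- Operator monotonicity of `t ↦ t ^ (j / k)`, phrased through `k`-th roots. -/
lemma pow_le_pow_of_pow_le_pow {ι : Type} [Fintype ι] [DecidableEq ι] {R S : Matrix ι ι ℂ}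
    (hR : R.PosSemidef) (hS : S.PosSemidef) {j k : ℕ} (hk : k ≠ 0) (hjk : j ≤ k)
    (h : R ^ k ≤ S ^ k) : R ^ j ≤ S ^ j := by
  have key : ∀ T : Matrix ι ι ℂ, T.PosSemidef → (T ^ k) ^ ((j : ℝ) / k) = T ^ j := by
    intro T hT
    have hT0 : 0 ≤ T := hT.nonneg
    rw [← CFC.rpow_natCast T k, CFC.rpow_rpow_of_exponent_nonneg T _ _ (by positivity)
      (by positivity), mul_div_cancel₀ _ (by exact_mod_cast hk),
      CFC.rpow_natCast T j]
  rw [← key R hR, ← key S hS]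
  refine CFC.rpow_le_rpow ⟨by positivity, ?_⟩ h
  exact div_le_one_of_le₀ (by exact_mod_cast hjk) (by positivity)

open scoped MatrixOrder Matrix.Norms.L2Operator in
lemma Matrix.PosSemidef.exists_pow_eq {ι : Type} [Fintype ι] [DecidableEq ι]
    {A : Matrix ι ι ℂ} (hA : A.PosSemidef) {k : ℕ} (hk : k ≠ 0) :
    ∃ R : Matrix ι ι ℂ, R.PosSemidef ∧ R ^ k = A := by
  have hA0 : 0 ≤ A := hA.nonneg
  refine ⟨A ^ ((1 : ℝ) / k), Matrix.nonneg_iff_posSemidef.mp CFC.rpow_nonneg, ?_⟩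
  rw [← CFC.rpow_natCast _ k CFC.rpow_nonneg, CFC.rpow_rpow_of_exponent_nonneg A _ _ (by positivity)
    (by positivity), one_div_mul_cancel (by exact_mod_cast hk), CFC.rpow_one A]

/-- The spectral projection of a Hermitian matrix onto its nonnegative part. -/
lemma exists_test_posPart {ι : Type} [Fintype ι] [DecidableEq ι] {H : Matrix ι ι ℂ}
    (hH : H.IsHermitian) :
    ∃ Q : Matrix ι ι ℂ, Q.PosSemidef ∧ (1 - Q).PosSemidef ∧ (Q * H).PosSemidef ∧
      (Q * H - H).PosSemidef := by
  set U : Matrix ι ι ℂ := (hH.eigenvectorUnitary : Matrix ι ι ℂ) with hU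
  have hUU : Uᴴ * U = 1 := by
    simpa [star_eq_conjTranspose] using Unitary.coe_star_mul_self hH.eigenvectorUnitary
  have hUU' : U * Uᴴ = 1 := by
    simpa [star_eq_conjTranspose] using Unitary.coe_mul_star_self hH.eigenvectorUnitary
  have hHd : H = U * diagonal (fun i => (hH.eigenvalues i : ℂ)) * Uᴴ := by
    conv_lhs => rw [hH.spectral_theorem]
    simp [Unitary.conjStarAlgAut_apply, hU, star_eq_conjTranspose, Function.comp_def]
  set e := hH.eigenvalues
  have psd : ∀ d : ι → ℝ, (∀ i, 0 ≤ d i) →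
      (U * diagonal (fun i => (d i : ℂ)) * Uᴴ).PosSemidef := fun d hd =>
    (PosSemidef.diagonal (d := fun i => (d i : ℂ))
      (fun i => by simpa using hd i)).mul_mul_conjTranspose_same U
  have hQH : U * diagonal (fun i => ((if 0 ≤ e i then 1 else 0 : ℝ) : ℂ)) * Uᴴ * H =
      U * diagonal (fun i => ((if 0 ≤ e i then e i else 0 : ℝ) : ℂ)) * Uᴴ := by
    conv_lhs => rw [hHd]
    rw [show ∀ a b c d f g : Matrix ι ι ℂ, a * b * c * (d * f * g) = a * (b * (c * d) * f) * g by
      intros; simp only [Matrix.mul_assoc], hUU, Matrix.mul_one, diagonal_mul_diagonal]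
    congr 3
    ext i
    split_ifs <;> simp
  refine ⟨U * diagonal (fun i => ((if 0 ≤ e i then 1 else 0 : ℝ) : ℂ)) * Uᴴ,
    psd _ (fun i => by split_ifs <;> norm_num), ?_, ?_, ?_⟩
  · have : (1 : Matrix ι ι ℂ) - U * diagonal (fun i => ((if 0 ≤ e i then 1 else 0 : ℝ) : ℂ)) * Uᴴ =
        U * diagonal (fun i => ((if 0 ≤ e i then 0 else 1 : ℝ) : ℂ)) * Uᴴ := by
      conv_lhs => rw [← hUU', ← Matrix.mul_one U, Matrix.mul_assoc U 1, Matrix.one_mul]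
      rw [Matrix.mul_one, Matrix.mul_assoc, ← Matrix.mul_sub, Matrix.mul_assoc]
      congr 1
      conv_lhs => rw [← Matrix.one_mul Uᴴ]
      rw [← Matrix.mul_assoc, Matrix.mul_one, ← Matrix.sub_mul, ← diagonal_one, diagonal_sub]
      congr 2
      ext i
      split_ifs <;> simp
    rw [this]
    exact psd _ (fun i => by split_ifs <;> norm_num)
  · rw [hQH]
    exact psd _ (fun i => by split_ifs with h; exacts [h, le_rfl])
  · rw [hQH]
    have : U * diagonal (fun i => ((if 0 ≤ e i then e i else 0 : ℝ) : ℂ)) * Uᴴ - H =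
        U * diagonal (fun i => ((if 0 ≤ e i then 0 else - e i : ℝ) : ℂ)) * Uᴴ := by
      conv_lhs => rw [hHd]
      rw [← Matrix.sub_mul, ← Matrix.mul_sub, diagonal_sub]
      congr 3
      ext i
      split_ifs <;> simp
    rw [this]
    exact psd _ (fun i => by split_ifs <;> linarith)

open scoped MatrixOrder Matrix.Norms.L2Operator in
/-- The quantum Chernoff-type inequality of Audenaert et al., for the exponents
`k / (k + 1)` and `1 / (k + 1)`. -/
lemma exists_test_of_roots {ι : Type} [Fintype ι] [DecidableEq ι] {R S : Matrix ι ι ℂ}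
    (hR : R.PosSemidef) (hS : S.PosSemidef) (k : ℕ) :
    ∃ Q : Matrix ι ι ℂ, Q.PosSemidef ∧ (1 - Q).PosSemidef ∧
      ((1 - Q) * R ^ (k + 1)).trace.re + (Q * S ^ (k + 1)).trace.re ≤ (R ^ k * S).trace.re ∧
      (Q * S ^ (k + 1)).trace.re ≤ (Q * R ^ (k + 1)).trace.re := by
  obtain ⟨Q, hQ, hQ1, hΔ, hΔH⟩ := exists_test_posPart
    ((hR.pow (k + 1)).isHermitian.sub (hS.pow (k + 1)).isHermitian)
  set Δ := Q * (R ^ (k + 1) - S ^ (k + 1)) with hΔdef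
  obtain ⟨C, hC, hCpow⟩ := ((hS.pow (k + 1)).add hΔ).exists_pow_eq (k := k + 1) (by omega)
  have hRC : R ^ (k + 1) ≤ C ^ (k + 1) := by
    rw [hCpow, Matrix.le_iff]
    rwa [add_sub_right_comm, ← neg_sub, neg_add_eq_sub]
  have hSC : S ^ (k + 1) ≤ C ^ (k + 1) := by
    rw [hCpow, Matrix.le_iff]
    simpa using hΔ
  have hRC1 : R ≤ C := by simpa using pow_le_pow_of_pow_le_pow hR hC (j := 1) (by omega) (by omega) hRC
  have hSC1 : S ≤ C := by simpa using pow_le_pow_of_pow_le_pow hS hC (j := 1) (by omega) (by omega) hSC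
  have hRCk : R ^ k ≤ C ^ k := pow_le_pow_of_pow_le_pow hR hC (by omega) (by omega) hRC
  have hSCk : S ^ k ≤ C ^ k := pow_le_pow_of_pow_le_pow hS hC (by omega) (by omega) hSC
  have t1 := re_trace_mul_le_of_le (hR.pow k) (sub_le_sub_right hRC1 S)
  have t2 := re_trace_mul_le_of_le (Matrix.le_iff.mp hSC1) hRCk
  have t3 := re_trace_mul_le_of_le hS hSCk
  rw [trace_mul_comm, trace_mul_comm (C - S)] at t2
  rw [trace_mul_comm, trace_mul_comm S] at t3
  have e : (C ^ k * C).trace = (S ^ (k + 1)).trace + Δ.trace := by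
    rw [← pow_succ, hCpow, trace_add]
  simp only [Matrix.mul_sub, trace_sub, Complex.sub_re, ← pow_succ] at t1 t2 t3 e
  rw [e, Complex.add_re] at t2
  have hΔtr : Δ.trace.re = (Q * R ^ (k + 1)).trace.re - (Q * S ^ (k + 1)).trace.re := by
    rw [hΔdef, Matrix.mul_sub, trace_sub, Complex.sub_re]
  refine ⟨Q, hQ, hQ1, ?_, ?_⟩
  · rw [Matrix.sub_mul, Matrix.one_mul, trace_sub, Complex.sub_re]
    linarith
  · have := hΔ.re_trace_nonneg
    linarith

end MatrixPreliminaries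

section SpectralOverlap

open Matrix

lemma trace_conj_diagonal_mul {ι : Type} [Fintype ι] [DecidableEq ι] (U V : Matrix ι ι ℂ)
    (x y : ι → ℝ) :
    ((U * diagonal (fun i => (x i : ℂ)) * Uᴴ) * (V * diagonal (fun i => (y i : ℂ)) * Vᴴ)).trace.re =
      ∑ i, ∑ j, Complex.normSq ((Uᴴ * V) i j) * (x i * y j) := by
  have e : ((U * diagonal (fun i => (x i : ℂ)) * Uᴴ) *
      (V * diagonal (fun i => (y i : ℂ)) * Vᴴ)).trace =
      (diagonal (fun i => (x i : ℂ)) * (Uᴴ * V) * (diagonal (fun i => (y i : ℂ)) * (Uᴴ * V)ᴴ)).trace := by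
    rw [show ∀ a b c d f g : Matrix ι ι ℂ, a * b * c * (d * f * g) = a * (b * (c * d) * (f * g)) by
      intros; simp only [Matrix.mul_assoc], trace_mul_comm, conjTranspose_mul,
      conjTranspose_conjTranspose]
    simp only [Matrix.mul_assoc]
  rw [e]
  simp only [trace, diag_apply, Matrix.mul_apply (M := diagonal _ * (Uᴴ * V)), diagonal_mul,
    conjTranspose_apply, Complex.re_sum]
  refine Finset.sum_congr rfl fun i _ => Finset.sum_congr rfl fun j _ => ?_
  rw [show ∀ p q z w : ℂ, p * z * (q * w) = (p * q) * (z * w) by intros; ring, Complex.star_def,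
    Complex.mul_conj, ← Complex.ofReal_mul, ← Complex.ofReal_mul, Complex.ofReal_re, mul_comm]

/-- The spectral data of a positive semidefinite matrix. -/
structure IsSpectral {ι : Type} [Fintype ι] [DecidableEq ι] (A U : Matrix ι ι ℂ) (a : ι → ℝ) :
    Prop where
  star_mul : Uᴴ * U = 1
  mul_star : U * Uᴴ = 1
  nonneg : ∀ i, 0 ≤ a i
  eq : A = U * diagonal (fun i => (a i : ℂ)) * Uᴴ
  matLog2_eq : matLog2 A =
    U * diagonal (fun i => ((if a i = 0 then 0 else Real.logb 2 (a i) : ℝ) : ℂ)) * Uᴴ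

lemma Matrix.PosSemidef.exists_isSpectral {ι : Type} [Fintype ι] [DecidableEq ι]
    {A : Matrix ι ι ℂ} (hA : A.PosSemidef) : ∃ U a, IsSpectral A U a := by
  have hH := hA.isHermitian
  refine ⟨(hH.eigenvectorUnitary : Matrix ι ι ℂ), hH.eigenvalues, ?_, ?_, hA.eigenvalues_nonneg,
    ?_, ?_⟩
  · simpa [star_eq_conjTranspose] using Unitary.coe_star_mul_self hH.eigenvectorUnitary
  · simpa [star_eq_conjTranspose] using Unitary.coe_mul_star_self hH.eigenvectorUnitary
  · conv_lhs => rw [hH.spectral_theorem]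
    simp [Unitary.conjStarAlgAut_apply, star_eq_conjTranspose, Function.comp_def]
  · rw [matLog2, hermFun, dif_pos hH, star_eq_conjTranspose]

/-- The squared overlaps of two orthonormal bases. -/
def overlap {ι : Type} [Fintype ι] (U V : Matrix ι ι ℂ) (i j : ι) : ℝ :=
  Complex.normSq ((Uᴴ * V) i j)

/-- The quasi-entropy `∑ᵢⱼ wᵢⱼ aᵢ ^ (1 + u) bⱼ ^ (-u)` over nonzero `aᵢ`, `bⱼ`. -/
def overlapSum {ι : Type} [Fintype ι] (w : ι → ι → ℝ) (a b : ι → ℝ) (u : ℝ) : ℝ :=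
  ∑ i, ∑ j, w i j * if a i = 0 ∨ b j = 0 then 0 else a i ^ (1 + u) * b j ^ (-u)

lemma hasDerivAt_overlapSum {ι : Type} [Fintype ι] (w : ι → ι → ℝ) {a b : ι → ℝ}
    (ha : ∀ i, 0 ≤ a i) (hb : ∀ i, 0 ≤ b i) :
    HasDerivAt (overlapSum w a b)
      (Real.log 2 * ∑ i, ∑ j, w i j *
        if a i = 0 ∨ b j = 0 then 0 else a i * (Real.logb 2 (a i) - Real.logb 2 (b j))) 0 := by
  rw [Finset.mul_sum]
  refine HasDerivAt.fun_sum fun i _ => ?_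
  rw [Finset.mul_sum]
  refine HasDerivAt.fun_sum fun j _ => ?_
  by_cases h : a i = 0 ∨ b j = 0
  · simpa [h] using hasDerivAt_const (0 : ℝ) (0 : ℝ)
  · simp only [h, if_false]
    push Not at h
    have hai := (ha i).lt_of_ne' h.1
    have hbj := (hb j).lt_of_ne' h.2
    have h1 : HasDerivAt (fun u : ℝ => a i ^ (1 + u)) _ 0 :=
      ((hasDerivAt_id (0 : ℝ)).const_add 1).const_rpow hai
    have h2 : HasDerivAt (fun u : ℝ => b j ^ (-u)) _ 0 :=
      ((hasDerivAt_id (0 : ℝ)).neg).const_rpow hbj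
    refine ((h1.fun_mul h2).const_mul (w i j)).congr_deriv ?_
    simp [Real.logb]
    field_simp
    ring

lemma eventually_lt_one_of_deriv_pos {g : ℝ → ℝ} {d : ℝ} (hg : HasDerivAt g d 0) (h0 : g 0 = 1)
    (hd : 0 < d) : ∀ᶠ u in nhdsWithin 0 (Set.Iio 0), g u < 1 := by
  have h1 := (hasDerivAt_iff_tendsto_slope.mp hg).eventually (lt_mem_nhds hd)
  have h2 : nhdsWithin (0 : ℝ) (Set.Iio 0) ≤ nhdsWithin 0 {0}ᶜ :=
    nhdsWithin_mono _ (by intro x hx; simpa using ne_of_lt hx)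
  filter_upwards [h2 h1, self_mem_nhdsWithin] with u hu hu0
  rw [slope_def_field, sub_zero, h0] at hu
  have : u < 0 := hu0
  by_contra! hcon
  exact absurd hu (not_lt.mpr (div_nonpos_of_nonneg_of_nonpos (by linarith) this.le))

lemma overlapSum_zero_add {ι : Type} [Fintype ι] (w : ι → ι → ℝ) (a b : ι → ℝ) :
    overlapSum w a b 0 + ∑ i, ∑ j, (if b j = 0 then w i j * a i else 0) =
      ∑ i, ∑ j, w i j * a i := by
  simp only [overlapSum, ← Finset.sum_add_distrib]
  refine Finset.sum_congr rfl fun i _ => Finset.sum_congr rfl fun j _ => ?_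
  by_cases h1 : a i = 0 <;> by_cases h2 : b j = 0 <;> simp [h1, h2]

lemma IsSpectral.sum_overlap_mul {ι : Type} [Fintype ι] [DecidableEq ι]
    {ρ σ U V : Matrix ι ι ℂ} {a b : ι → ℝ} (hρ : IsSpectral ρ U a) (hσ : IsSpectral σ V b)
    (htr : ρ.trace = 1) : ∑ i, ∑ j, overlap U V i j * a i = 1 := by
  have h := trace_conj_diagonal_mul U V a 1
  rw [← hρ.eq] at h
  simp only [Pi.one_apply, Complex.ofReal_one, mul_one] at h
  rw [show (diagonal fun _ : ι => (1 : ℂ)) = 1 from diagonal_one, Matrix.mul_one, hσ.mul_star,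
    Matrix.mul_one, htr] at h
  simpa [overlap] using h.symm

lemma IsSpectral.suppLE_iff {ι : Type} [Fintype ι] [DecidableEq ι]
    {ρ σ U V : Matrix ι ι ℂ} {a b : ι → ℝ} (hρ : IsSpectral ρ U a) (hσ : IsSpectral σ V b) :
    suppLE ρ σ ↔ ∀ i j, b j = 0 → overlap U V i j * a i = 0 := by
  constructor
  · intro h i j hj
    have h1 : σ *ᵥ (V *ᵥ Pi.single j 1) = 0 := by
      rw [mulVec_mulVec, hσ.eq, Matrix.mul_assoc, hσ.star_mul, Matrix.mul_one, ← mulVec_mulVec,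
        diagonal_mulVec_single, hj]
      simp
    have h2 := congrArg (fun v => (Uᴴ *ᵥ v) i) (h _ h1)
    simp only [hρ.eq, mulVec_mulVec, mulVec_zero, Pi.zero_apply] at h2
    rw [show Uᴴ * (U * diagonal (fun i => (a i : ℂ)) * Uᴴ * V) =
        diagonal (fun i => (a i : ℂ)) * (Uᴴ * V) by
      rw [← Matrix.mul_assoc, ← Matrix.mul_assoc, ← Matrix.mul_assoc, hρ.star_mul, Matrix.one_mul,
        Matrix.mul_assoc], mulVec_single_one, col_apply, diagonal_mul] at h2
    rcases mul_eq_zero.mp h2 with h3 | h3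
    · simp [Complex.ofReal_eq_zero.mp h3]
    · simp [overlap, h3]
  · intro h v hv
    have h1 : ∀ j, (b j : ℂ) * (Vᴴ *ᵥ v) j = 0 := by
      intro j
      have := congrArg (fun v => (Vᴴ *ᵥ v) j) hv
      simp only [hσ.eq, mulVec_mulVec, mulVec_zero, Pi.zero_apply] at this
      rwa [← Matrix.mul_assoc, ← Matrix.mul_assoc, hσ.star_mul, Matrix.one_mul, ← mulVec_mulVec,
        mulVec_diagonal] at this
    have h2 : diagonal (fun i => (a i : ℂ)) *ᵥ ((Uᴴ * V) *ᵥ (Vᴴ *ᵥ v)) = 0 := by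
      ext i
      rw [mulVec_diagonal, mulVec, dotProduct, Finset.mul_sum]
      refine Finset.sum_eq_zero fun j _ => ?_
      rcases mul_eq_zero.mp (h1 j) with h3 | h3
      · rcases mul_eq_zero.mp (h i j (Complex.ofReal_eq_zero.mp h3)) with h4 | h4
        · simp [Complex.normSq_eq_zero.mp h4]
        · simp [h4]
      · simp [h3]
    have h3 : ρ *ᵥ v = U *ᵥ (diagonal (fun i => (a i : ℂ)) *ᵥ ((Uᴴ * V) *ᵥ (Vᴴ *ᵥ v))) := by
      simp only [mulVec_mulVec, hρ.eq]
      rw [show Uᴴ * V * Vᴴ = Uᴴ by rw [Matrix.mul_assoc, hσ.mul_star, Matrix.mul_one],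
        Matrix.mul_assoc]
    rw [h3, h2, mulVec_zero]

lemma IsSpectral.relEnt_eq {ι : Type} [Fintype ι] [DecidableEq ι]
    {ρ σ U V : Matrix ι ι ℂ} {a b : ι → ℝ} (hρ : IsSpectral ρ U a) (hσ : IsSpectral σ V b)
    (hs : suppLE ρ σ) :
    relEnt ρ σ = ((∑ i, ∑ j, overlap U V i j *
        if a i = 0 ∨ b j = 0 then 0 else a i * (Real.logb 2 (a i) - Real.logb 2 (b j)) : ℝ) :
          EReal) := by
  rw [relEnt, if_pos hs, Matrix.mul_sub, trace_sub, Complex.sub_re]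
  have h1 : (ρ * matLog2 ρ).trace.re = ∑ i, ∑ j, overlap U V i j *
      (a i * if a i = 0 then 0 else Real.logb 2 (a i)) := by
    have h := trace_conj_diagonal_mul U V
      (fun i => a i * if a i = 0 then 0 else Real.logb 2 (a i)) 1
    simp only [Pi.one_apply, Complex.ofReal_one, mul_one] at h
    rw [show (diagonal fun _ : ι => (1 : ℂ)) = 1 from diagonal_one, Matrix.mul_one, hσ.mul_star,
      Matrix.mul_one] at h
    rw [hρ.matLog2_eq]
    nth_rewrite 1 [hρ.eq]
    rw [show ∀ a b c d f g : Matrix ι ι ℂ, a * b * c * (d * f * g) = a * (b * (c * d) * f) * g by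
      intros; simp only [Matrix.mul_assoc], hρ.star_mul, Matrix.mul_one, diagonal_mul_diagonal]
    simpa only [overlap, Complex.ofReal_mul] using h
  have h2 : (ρ * matLog2 σ).trace.re = ∑ i, ∑ j, overlap U V i j *
      (a i * if b j = 0 then 0 else Real.logb 2 (b j)) := by
    rw [hσ.matLog2_eq]
    nth_rewrite 1 [hρ.eq]
    exact trace_conj_diagonal_mul U V _ _
  rw [h1, h2]
  simp only [← Finset.sum_sub_distrib]
  congr 1
  refine Finset.sum_congr rfl fun i _ => Finset.sum_congr rfl fun j _ => ?_
  by_cases hb : b j = 0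
  · rcases mul_eq_zero.mp ((hρ.suppLE_iff hσ).mp hs i j hb) with h | h <;> simp [h]
  · by_cases ha : a i = 0 <;> simp [ha, hb]
    ring

lemma IsSpectral.overlapSum_zero_of_suppLE {ι : Type} [Fintype ι] [DecidableEq ι]
    {ρ σ U V : Matrix ι ι ℂ} {a b : ι → ℝ} (hρ : IsSpectral ρ U a) (hσ : IsSpectral σ V b)
    (htr : ρ.trace = 1) (hs : suppLE ρ σ) : overlapSum (overlap U V) a b 0 = 1 := by
  have h := overlapSum_zero_add (overlap U V) a b
  rw [hρ.sum_overlap_mul hσ htr, Finset.sum_eq_zero, add_zero] at h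
  · exact h
  · intro i _
    refine Finset.sum_eq_zero fun j _ => ?_
    split_ifs with hj
    · exact (hρ.suppLE_iff hσ).mp hs i j hj
    · rfl

lemma hasDerivAt_overlapSum_mul_rpow {ι : Type} [Fintype ι] (w : ι → ι → ℝ) {a b : ι → ℝ}
    (ha : ∀ i, 0 ≤ a i) (hb : ∀ i, 0 ≤ b i) (h0 : overlapSum w a b 0 = 1) (r : ℝ) :
    HasDerivAt (fun u => overlapSum w a b u * 2 ^ (-r * u))
      (Real.log 2 * ((∑ i, ∑ j, w i j *
        if a i = 0 ∨ b j = 0 then 0 else a i * (Real.logb 2 (a i) - Real.logb 2 (b j))) - r)) 0 := by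
  have h1 : HasDerivAt (fun u : ℝ => (2 : ℝ) ^ (-r * u)) _ 0 :=
    ((hasDerivAt_id (0 : ℝ)).const_mul (-r)).const_rpow two_pos
  refine ((hasDerivAt_overlapSum w ha hb).fun_mul h1).congr_deriv ?_
  simp [h0]
  ring

lemma lt_rpow_of_mul_rpow_neg_lt_one {x r u : ℝ} (h : x * 2 ^ (-r * u) < 1) : x < 2 ^ (r * u) := by
  rw [neg_mul, Real.rpow_neg two_pos.le, ← div_eq_mul_inv, div_lt_one (by positivity)] at h
  exact h

lemma IsSpectral.eventually_lt_of_lt_relEnt {ι : Type} [Fintype ι] [DecidableEq ι]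
    {ρ σ U V : Matrix ι ι ℂ} {a b : ι → ℝ} (hρ : IsSpectral ρ U a) (hσ : IsSpectral σ V b)
    (htr : ρ.trace = 1) {r : ℝ} (hr : (r : EReal) < relEnt ρ σ) :
    ∀ᶠ u in nhdsWithin (0 : ℝ) (Set.Iio 0), overlapSum (overlap U V) a b u < 2 ^ (r * u) := by
  by_cases hs : suppLE ρ σ
  · rw [hρ.relEnt_eq hσ hs, EReal.coe_lt_coe_iff] at hr
    have h0 := hρ.overlapSum_zero_of_suppLE hσ htr hs
    filter_upwards [eventually_lt_one_of_deriv_pos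
      (hasDerivAt_overlapSum_mul_rpow (overlap U V) hρ.nonneg hσ.nonneg h0 r) (by simp [h0])
      (mul_pos (Real.log_pos one_lt_two) (sub_pos.mpr hr))] with u hu
    exact lt_rpow_of_mul_rpow_neg_lt_one hu
  · have hlt : overlapSum (overlap U V) a b 0 < 1 := by
      have h := overlapSum_zero_add (overlap U V) a b
      rw [hρ.sum_overlap_mul hσ htr] at h
      have nn : ∀ i j, 0 ≤ if b j = 0 then overlap U V i j * a i else 0 := by
        intro i j
        split_ifs
        · exact mul_nonneg (Complex.normSq_nonneg _) (hρ.nonneg i)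
        · exact le_rfl
      have hpos : 0 < ∑ i, ∑ j, (if b j = 0 then overlap U V i j * a i else 0) := by
        rw [hρ.suppLE_iff hσ] at hs
        push Not at hs
        obtain ⟨i, j, hj, hij⟩ := hs
        refine Finset.sum_pos' (fun i _ => Finset.sum_nonneg fun j _ => nn i j)
          ⟨i, Finset.mem_univ _, Finset.sum_pos' (fun j _ => nn i j) ⟨j, Finset.mem_univ _, ?_⟩⟩
        have := nn i j
        rw [if_pos hj] at this ⊢
        exact this.lt_of_ne' hij
      linarith
    have hc : ContinuousAt (fun u : ℝ => overlapSum (overlap U V) a b u * 2 ^ (-r * u)) 0 :=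
      (hasDerivAt_overlapSum _ hρ.nonneg hσ.nonneg).continuousAt.mul
        (by fun_prop (disch := norm_num))
    have := hc.eventually (gt_mem_nhds (by simpa using hlt))
    filter_upwards [nhdsWithin_le_nhds this] with u hu
    exact lt_rpow_of_mul_rpow_neg_lt_one hu

lemma IsSpectral.eventually_lt_of_relEnt_lt {ι : Type} [Fintype ι] [DecidableEq ι]
    {ρ σ U V : Matrix ι ι ℂ} {a b : ι → ℝ} (hρ : IsSpectral ρ U a) (hσ : IsSpectral σ V b)
    (htr : ρ.trace = 1) {r : ℝ} (hs : suppLE ρ σ) (hr : relEnt ρ σ < r) :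
    ∀ᶠ u in nhdsWithin (0 : ℝ) (Set.Ioi 0), overlapSum (overlap U V) a b u < 2 ^ (r * u) := by
  rw [hρ.relEnt_eq hσ hs, EReal.coe_lt_coe_iff] at hr
  have h0 := hρ.overlapSum_zero_of_suppLE hσ htr hs
  have hd := hasDerivAt_overlapSum_mul_rpow (overlap U V) hρ.nonneg hσ.nonneg h0 r
  have hd' := HasDerivAt.comp (0 : ℝ) (h := fun u : ℝ => -u) (by rw [neg_zero]; exact hd)
    (hasDerivAt_neg (0 : ℝ))
  have ht : Filter.Tendsto (fun u : ℝ => -u) (nhdsWithin 0 (Set.Ioi 0))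
      (nhdsWithin 0 (Set.Iio 0)) := by
    simpa using tendsto_neg_nhdsGT (a := (0 : ℝ))
  have := eventually_lt_one_of_deriv_pos hd' (by simp [h0])
    (by have := mul_pos (Real.log_pos one_lt_two) (sub_pos.mpr hr); nlinarith)
  filter_upwards [ht.eventually this] with u hu
  exact lt_rpow_of_mul_rpow_neg_lt_one (by simpa using hu)

end SpectralOverlap

section Achievability

open Matrix Kronecker

lemma coe_inv_succ (m : ℕ) : (((m + 1 : ℝ))⁻¹ : EReal) = ((((m : ℝ) + 1)⁻¹ : ℝ) : EReal) := by
  push_cast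
  rfl

lemma le_inv_mul_negLog2 {b r : ℝ} {m : ℕ} (h : b ≤ 2 ^ (-(r * (m + 1)))) :
    (r : EReal) ≤ (((m + 1 : ℝ))⁻¹ : EReal) * negLog2 b := by
  have hm : (0 : ℝ) < (m : ℝ) + 1 := by positivity
  rw [coe_inv_succ, negLog2]
  split_ifs with hb
  · rw [EReal.coe_mul_top_of_pos (by positivity)]
    exact le_top
  · rw [← EReal.coe_mul, EReal.coe_le_coe_iff, le_inv_mul_iff₀ hm]
    have := Real.logb_le_logb_of_le one_lt_two (not_le.mp hb) h
    rw [Real.logb_rpow two_pos (by norm_num)] at this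
    linarith

lemma inv_mul_negLog2_le {b r : ℝ} {m : ℕ} (h : 2 ^ (-(r * (m + 1))) ≤ b) :
    (((m + 1 : ℝ))⁻¹ : EReal) * negLog2 b ≤ r := by
  have hm : (0 : ℝ) < (m : ℝ) + 1 := by positivity
  have hp : (0 : ℝ) < 2 ^ (-(r * (m + 1))) := by positivity
  rw [coe_inv_succ, negLog2, if_neg (not_le.mpr (hp.trans_le h)), ← EReal.coe_mul,
    EReal.coe_le_coe_iff, inv_mul_le_iff₀ hm]
  have := Real.logb_le_logb_of_le one_lt_two hp h
  rw [Real.logb_rpow two_pos (by norm_num)] at this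
  linarith

/-- The state `S ⊗ |x⟩⟨x|`. -/
def appendPure {R X : Type} (x : X) (S : Matrix R R ℂ) : Matrix (R × X) (R × X) ℂ :=
  fun p q => if p.2 = x ∧ q.2 = x then S p.1 q.1 else 0

lemma appendPure_posSemidef {R X : Type} [Fintype R] [Fintype X] (x : X) {S : Matrix R R ℂ}
    (hS : S.PosSemidef) : (appendPure x S).PosSemidef := by
  have e : appendPure x S = S ⊗ₖ vecMulVec (Pi.single x 1) (star (Pi.single x (1 : ℂ))) := by
    ext p q
    by_cases h1 : p.2 = x <;> by_cases h2 : q.2 = x <;>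
      simp [appendPure, vecMulVec_apply, h1, h2]
  rw [e]
  exact hS.kronecker (posSemidef_vecMulVec_self_star _)

lemma trace_appendPure {R X : Type} [Fintype R] [Fintype X] (x : X) (S : Matrix R R ℂ) :
    (appendPure x S).trace = S.trace := by
  simp [trace, appendPure, Fintype.sum_prod_type]

lemma idTensor_cqChannel {R X B : Type} [Fintype X] [Fintype B] (ν : X → Matrix B B ℂ)
    (ρ : Matrix (R × X) (R × X) ℂ) :
    idTensor (cqChannel ν) ρ = ∑ x, (ρ.submatrix (fun r => (r, x)) fun r => (r, x)) ⊗ₖ ν x := by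
  ext p q
  simp [idTensor, cqChannel, Matrix.sum_apply]

lemma idTensor_cqChannel_appendPure {R X B : Type} [Fintype X] [Fintype B]
    (ν : X → Matrix B B ℂ) (x : X) (S : Matrix R R ℂ) :
    idTensor (cqChannel ν) (appendPure x S) = S ⊗ₖ ν x := by
  rw [idTensor_cqChannel, Finset.sum_eq_single x]
  · congr 1
    ext p q
    simp [appendPure]
  · intro y _ hy
    ext p q
    simp [appendPure, hy]
  · simp

/-- Regrouping of an `i`-fold register and one more system. -/
def powEquiv (B : Type) [Fintype B] (i : ℕ) :
    Fin (Fintype.card B ^ i) × B ≃ Fin (Fintype.card B ^ (i + 1)) :=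
  ((Equiv.refl _).prodCongr (Fintype.equivFin B)).trans
    (finProdFinEquiv.trans (finCongr (pow_succ _ _).symm))

/-- The `i`-fold tensor power of a matrix, on a register of dimension `(dim B) ^ i`. -/
def iterKron {B : Type} [Fintype B] (A : Matrix B B ℂ) :
    (i : ℕ) → Matrix (Fin (Fintype.card B ^ i)) (Fin (Fintype.card B ^ i)) ℂ
  | 0 => 1
  | i + 1 => (iterKron A i ⊗ₖ A).submatrix (powEquiv B i).symm (powEquiv B i).symm

variable {B : Type} [Fintype B]

lemma iterKron_posSemidef {A : Matrix B B ℂ} (hA : A.PosSemidef) (i : ℕ) :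
    (iterKron A i).PosSemidef := by
  induction i with
  | zero => exact PosSemidef.one
  | succ i ih => exact (ih.kronecker hA).submatrix _

lemma iterKron_mul [DecidableEq B] (A C : Matrix B B ℂ) (i : ℕ) :
    iterKron (A * C) i = iterKron A i * iterKron C i := by
  induction i with
  | zero => exact (Matrix.mul_one _).symm
  | succ i ih => rw [iterKron, iterKron, iterKron, submatrix_mul_equiv, ih, mul_kronecker_mul]

lemma trace_iterKron (A : Matrix B B ℂ) (i : ℕ) : (iterKron A i).trace = A.trace ^ i := by
  induction i with
  | zero =>
    rw [iterKron, trace_one]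
    simp
  | succ i ih =>
    have : ((iterKron A i ⊗ₖ A).submatrix (powEquiv B i).symm (powEquiv B i).symm).trace =
        (iterKron A i ⊗ₖ A).trace := by
      simp only [trace, diag_apply, submatrix_apply]
      exact (powEquiv B i).symm.sum_comp (fun p => (iterKron A i ⊗ₖ A) p p)
    rw [iterKron, this, trace_kronecker, ih, pow_succ]

/-- Tensor powers regarded as matrices on `R_m ⊗ B`. -/
def kronPow (m : ℕ) (A : Matrix B B ℂ) :
    Matrix (Fin (Fintype.card B ^ m) × B) (Fin (Fintype.card B ^ m) × B) ℂ :=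
  iterKron A m ⊗ₖ A

lemma kronPow_posSemidef (m : ℕ) {A : Matrix B B ℂ} (hA : A.PosSemidef) :
    (kronPow m A).PosSemidef :=
  (iterKron_posSemidef hA m).kronecker hA

lemma kronPow_mul [DecidableEq B] (m : ℕ) (A C : Matrix B B ℂ) :
    kronPow m (A * C) = kronPow m A * kronPow m C := by
  rw [kronPow, kronPow, kronPow, ← mul_kronecker_mul, iterKron_mul]

lemma kronPow_pow_succ [DecidableEq B] (m : ℕ) (A : Matrix B B ℂ) (k : ℕ) :
    kronPow m (A ^ (k + 1)) = kronPow m A ^ (k + 1) := by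
  induction k with
  | zero => simp
  | succ k ih => rw [pow_succ, kronPow_mul, ih, pow_succ _ (k + 1)]

lemma trace_kronPow (m : ℕ) (A : Matrix B B ℂ) : (kronPow m A).trace = A.trace ^ (m + 1) := by
  rw [kronPow, trace_kronecker, trace_iterKron, pow_succ]

/-- Append the received system to the memory and feed `|x⟩⟨x|` to the channel. -/
def storeChannel {X : Type} (x : X) (i : ℕ)
    (S : Matrix (Fin (Fintype.card B ^ i) × B) (Fin (Fintype.card B ^ i) × B) ℂ) :
    Matrix (Fin (Fintype.card B ^ (i + 1)) × X) (Fin (Fintype.card B ^ (i + 1)) × X) ℂ :=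
  appendPure x (S.submatrix (powEquiv B i).symm (powEquiv B i).symm)

lemma storeChannel_isChannel {X : Type} [Fintype X] (x : X) (i : ℕ) :
    IsChannel (storeChannel (B := B) x i) where
  linear := by
    constructor <;> intros <;> ext p q <;> by_cases h : p.2 = x ∧ q.2 = x <;>
      simp [storeChannel, appendPure, h]
  tracePres S := by
    rw [storeChannel, trace_appendPure]
    simp only [trace, diag_apply, submatrix_apply]
    exact (powEquiv B i).symm.sum_comp (fun p => S p p)
  compPos k Y hY := by
    have h := appendPure_posSemidef x (hY.submatrix
      fun p : Fin k × Fin (Fintype.card B ^ (i + 1)) => (p.1, (powEquiv B i).symm p.2))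
    exact h.submatrix fun p : Fin k × Fin (Fintype.card B ^ (i + 1)) × X => ((p.1, p.2.1), p.2.2)

/-- The non-adaptive protocol that always uses the input `|x⟩⟨x|`. -/
def constProtocol {X : Type} [Fintype X] [DecidableEq X] [DecidableEq B] (x : X) (m : ℕ)
    (Q : Matrix (Fin (Fintype.card B ^ m) × B) (Fin (Fintype.card B ^ m) × B) ℂ)
    (hQ : Q.PosSemidef) (hQ1 : (1 - Q).PosSemidef) : Protocol X B m where
  r i := Fintype.card B ^ i
  init := appendPure x 1
  init_density := ⟨appendPure_posSemidef x PosSemidef.one, by rw [trace_appendPure, trace_one]; simp⟩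
  adapt := storeChannel x
  adapt_channel i _ := storeChannel_isChannel x i
  meas := Q
  meas_psd := hQ
  meas_le_one := hQ1

lemma constProtocol_final {X : Type} [Fintype X] [DecidableEq X] [DecidableEq B] (x : X) (m : ℕ)
    (Q : Matrix (Fin (Fintype.card B ^ m) × B) (Fin (Fintype.card B ^ m) × B) ℂ)
    (hQ : Q.PosSemidef) (hQ1 : (1 - Q).PosSemidef) (ν : X → Matrix B B ℂ) :
    (constProtocol x m Q hQ hQ1).final (cqChannel ν) = kronPow m (ν x) := by
  have h : ∀ i, (constProtocol x m Q hQ hQ1).evolve (cqChannel ν) i =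
      appendPure x (iterKron (ν x) i) := by
    intro i
    induction i with
    | zero => rfl
    | succ i ih =>
      rw [Protocol.evolve, ih]
      exact congrArg (storeChannel x i) (idTensor_cqChannel_appendPure ν x (iterKron (ν x) i))
  rw [Protocol.final, h]
  exact idTensor_cqChannel_appendPure ν x (iterKron (ν x) m)

lemma trace_mul_eq_ofReal {ι : Type} [Fintype ι] {A C : Matrix ι ι ℂ} (hA : A.IsHermitian)
    (hC : C.IsHermitian) : (A * C).trace = ((A * C).trace.re : ℂ) := by
  refine (Complex.conj_eq_iff_re.mp ?_).symm
  rw [← Complex.star_def, ← trace_conjTranspose, conjTranspose_mul, hA.eq, hC.eq, trace_mul_comm]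

/-- Roots of spectrally decomposed matrices and the trace entering the test inequality. -/
lemma exists_roots_trace_eq [DecidableEq B] {ρ σ U V : Matrix B B ℂ} {a b : B → ℝ}
    (hρ : IsSpectral ρ U a) (hσ : IsSpectral σ V b) {k : ℕ} (hk : k ≠ 0) :
    ∃ R S : Matrix B B ℂ, R.PosSemidef ∧ S.PosSemidef ∧ R ^ (k + 1) = ρ ∧ S ^ (k + 1) = σ ∧
      (R ^ k * S).trace.re = overlapSum (overlap U V) a b (-((k : ℝ) + 1)⁻¹) := by
  have hpow : ∀ (W : Matrix B B ℂ), Wᴴ * W = 1 → W * Wᴴ = 1 → ∀ (d : B → ℝ) (n : ℕ),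
      (W * diagonal (fun i => (d i : ℂ)) * Wᴴ) ^ n =
        W * diagonal (fun i => ((d i ^ n : ℝ) : ℂ)) * Wᴴ := by
    intro W h1 h2 d n
    induction n with
    | zero => simp [h2]
    | succ n ih =>
      rw [pow_succ, ih, show ∀ a b c d f g : Matrix B B ℂ,
        a * b * c * (d * f * g) = a * (b * (c * d) * f) * g by
        intros; simp only [Matrix.mul_assoc], h1, Matrix.mul_one, diagonal_mul_diagonal]
      simp [pow_succ]
  have psd : ∀ (W : Matrix B B ℂ) (d : B → ℝ), (∀ i, 0 ≤ d i) →
      (W * diagonal (fun i => ((d i ^ ((k : ℝ) + 1)⁻¹ : ℝ) : ℂ)) * Wᴴ).PosSemidef := fun W d hd =>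
    (PosSemidef.diagonal (d := fun i => ((d i ^ ((k : ℝ) + 1)⁻¹ : ℝ) : ℂ))
      (fun i => by simpa using Real.rpow_nonneg (hd i) _)).mul_mul_conjTranspose_same W
  have root : ∀ x : ℝ, 0 ≤ x → (x ^ ((k : ℝ) + 1)⁻¹) ^ (k + 1) = x := by
    intro x hx
    exact_mod_cast Real.rpow_inv_natCast_pow hx (Nat.succ_ne_zero k)
  refine ⟨_, _, psd U a hρ.nonneg, psd V b hσ.nonneg, ?_, ?_, ?_⟩
  · rw [hpow U hρ.star_mul hρ.mul_star, hρ.eq]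
    simp only [root _ (hρ.nonneg _)]
  · rw [hpow V hσ.star_mul hσ.mul_star, hσ.eq]
    simp only [root _ (hσ.nonneg _)]
  · rw [hpow U hρ.star_mul hρ.mul_star, trace_conj_diagonal_mul, overlapSum]
    refine Finset.sum_congr rfl fun i _ => Finset.sum_congr rfl fun j _ => ?_
    rw [overlap]
    congr 1
    have hk1 : ((k : ℝ) + 1)⁻¹ ≠ 0 := by positivity
    by_cases ha : a i = 0
    · simp [ha, Real.zero_rpow hk1, hk]
    by_cases hb : b j = 0
    · simp [hb, Real.zero_rpow hk1]
    rw [if_neg (by tauto), neg_neg, ← Real.rpow_natCast, ← Real.rpow_mul (hρ.nonneg i)]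
    congr 2
    field_simp
    ring

lemma eventually_le_steinExp {X : Type} [Fintype X] [DecidableEq X] [DecidableEq B]
    {ν μ : X → Matrix B B ℂ} (hν : ∀ x, IsDensity (ν x)) (hμ : ∀ x, IsDensity (μ x)) {x : X}
    {r ε : ℝ} (hε : 0 < ε) (hr : (r : EReal) < relEnt (ν x) (μ x)) :
    ∀ᶠ m : ℕ in Filter.atTop, (r : EReal) ≤ steinExp (cqChannel ν) (cqChannel μ) m ε := by
  obtain ⟨U, a, hU⟩ := (hν x).1.exists_isSpectral
  obtain ⟨V, b, hV⟩ := (hμ x).1.exists_isSpectral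
  have hlim : Filter.Tendsto (fun k : ℕ => -((k : ℝ) + 1)⁻¹) Filter.atTop
      (nhdsWithin 0 (Set.Iio 0)) := by
    refine tendsto_nhdsWithin_iff.mpr ⟨?_, Filter.Eventually.of_forall fun k => ?_⟩
    · simpa using (tendsto_one_div_add_atTop_nhds_zero_nat (𝕜 := ℝ)).neg
    · exact neg_neg_of_pos (a := ((k : ℝ) + 1)⁻¹) (by positivity)
  obtain ⟨k, hk, hk0⟩ := ((hlim.eventually (hU.eventually_lt_of_lt_relEnt hV (hν x).2 hr)).and
    (Filter.eventually_ne_atTop (0 : ℕ))).exists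
  obtain ⟨R, S, hR, hS, hRν, hSμ, htr⟩ := exists_roots_trace_eq hU hV hk0
  rw [← htr] at hk
  set q := (R ^ k * S).trace.re with hq
  have hq0 : 0 ≤ q := (hR.pow k).re_trace_mul_nonneg hS
  set c : ℝ := 2 ^ (r * ((k : ℝ) + 1)⁻¹) with hc
  have hc0 : 0 < c := by positivity
  have hcq : c * q < 1 := by
    have : (2 : ℝ) ^ (r * -((k : ℝ) + 1)⁻¹) = c⁻¹ := by
      rw [mul_neg, Real.rpow_neg two_pos.le]
    rw [this] at hk
    calc c * q < c * c⁻¹ := by gcongr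
      _ = 1 := mul_inv_cancel₀ hc0.ne'
  have hck : c ^ (k + 1) = 2 ^ r := by
    rw [hc, ← Real.rpow_natCast, ← Real.rpow_mul two_pos.le]
    congr 1
    push_cast
    field_simp
  have hsmall := (tendsto_pow_atTop_nhds_zero_of_lt_one (by positivity) hcq).eventually
    (gt_mem_nhds hε)
  filter_upwards [(Filter.tendsto_add_atTop_nat 1).eventually hsmall] with m hm
  have hc' : (0 : ℂ) ≤ ((c ^ (m + 1) : ℝ) : ℂ) := by
    rw [Complex.zero_le_real]; positivity
  obtain ⟨Q, hQ, hQ1, h1, h2⟩ := exists_test_of_roots (kronPow_posSemidef m hR)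
    ((kronPow_posSemidef m hS).smul hc') k
  have hkR : kronPow m R ^ k = kronPow m (R ^ k) := by
    obtain ⟨l, rfl⟩ := Nat.exists_eq_succ_of_ne_zero hk0
    exact (kronPow_pow_succ m R l).symm
  have htrν : (kronPow m (ν x)).trace = 1 := by rw [trace_kronPow, (hν x).2, one_pow]
  have hββ := hQ.re_trace_mul_nonneg (kronPow_posSemidef m (hμ x).1)
  have hαα := hQ1.re_trace_mul_nonneg (kronPow_posSemidef m (hν x).1)
  have hsum : ((1 - Q) * kronPow m (ν x)).trace.re + (Q * kronPow m (ν x)).trace.re = 1 := by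
    rw [← Complex.add_re, ← trace_add, ← Matrix.add_mul, sub_add_cancel, Matrix.one_mul, htrν,
      Complex.one_re]
  rw [← kronPow_pow_succ, hRν, smul_pow, ← kronPow_pow_succ, hSμ, hkR, Matrix.mul_smul,
    Matrix.mul_smul, trace_smul, trace_smul, ← kronPow_mul, trace_kronPow,
    trace_mul_eq_ofReal (hR.pow k).isHermitian hS.isHermitian, ← hq] at h1
  rw [← kronPow_pow_succ, hRν, smul_pow, ← kronPow_pow_succ, hSμ, Matrix.mul_smul,
    trace_smul] at h2
  simp only [smul_eq_mul, ← Complex.ofReal_pow, Complex.re_ofReal_mul, Complex.ofReal_re] at h1 h2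
  rw [← pow_mul, mul_comm (m + 1), pow_mul, hck] at h1 h2
  have hpos : (0 : ℝ) < (2 ^ r) ^ (m + 1) := by positivity
  refine le_trans ?_ (le_iSup₂_of_le (constProtocol x m Q hQ hQ1) ?_ le_rfl)
  · refine le_inv_mul_negLog2 ?_
    rw [Protocol.typeII, constProtocol_final]
    change (Q * kronPow m (μ x)).trace.re ≤ _
    have : (2 : ℝ) ^ (-(r * ((m : ℝ) + 1))) = ((2 ^ r) ^ (m + 1))⁻¹ := by
      rw [Real.rpow_neg two_pos.le, Real.rpow_mul two_pos.le]
      norm_cast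
    rw [this, ← one_div, le_div_iff₀' hpos]
    linarith
  · rw [Protocol.typeI, constProtocol_final]
    change ((1 - Q) * kronPow m (ν x)).trace.re ≤ _
    rw [← mul_pow] at h1
    have := mul_nonneg hpos.le hββ
    linarith

end Achievability

section VariationalForm

open Matrix

/-- The quadratic functional whose supremum over `X` equals, for commuting `ρ` and `σ`, the trace
of `ρ² (ρ + t σ)⁻¹`. -/
def varForm {ι : Type} [Fintype ι] (t : ℝ) (ρ σ X : Matrix ι ι ℂ) : ℝ :=
  2 * (ρ * X).trace.re - (ρ * (X * Xᴴ)).trace.re - t * (σ * (Xᴴ * X)).trace.re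

/-- The nonnegative supremum of `varForm t ρ σ`. -/
def varSup {ι : Type} [Fintype ι] (t : ℝ) (ρ σ : Matrix ι ι ℂ) : ENNReal :=
  ⨆ X, ENNReal.ofReal (varForm t ρ σ X)

lemma measurable_varSup {ι : Type} [Fintype ι] (ρ σ : Matrix ι ι ℂ) :
    Measurable fun t => varSup t ρ σ := by
  refine (lowerSemicontinuous_iSup fun X => Continuous.lowerSemicontinuous ?_).measurable
  unfold varForm
  exact ENNReal.continuous_ofReal.comp (by fun_prop)

lemma varForm_zero {ι : Type} [Fintype ι] (t : ℝ) (ρ σ : Matrix ι ι ℂ) :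
    varForm t ρ σ 0 = 0 := by
  simp [varForm]

lemma le_varSup {ι : Type} [Fintype ι] (t : ℝ) (ρ σ X : Matrix ι ι ℂ) :
    ENNReal.ofReal (varForm t ρ σ X) ≤ varSup t ρ σ :=
  le_iSup (fun X => ENNReal.ofReal (varForm t ρ σ X)) X

/-- A completely positive map, tested against finitely many matrices. -/
lemma IsChannel.sum_re_trace_nonneg {ι κ : Type} [Fintype ι] [Fintype κ]
    {Φ : Matrix ι ι ℂ → Matrix κ κ ℂ} (hΦ : IsChannel Φ) {k : ℕ} (M : Fin k → Matrix ι ι ℂ)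
    (L : Fin k → Matrix κ κ ℂ) {S : Matrix ι ι ℂ} (hS : S.PosSemidef) :
    0 ≤ ∑ p, ∑ q, (Φ (M p * S * (M q)ᴴ) * (L q * (L p)ᴴ)).trace.re := by
  let K : Matrix (Fin k × ι) ι ℂ := fun p b => M p.1 p.2 b
  let J : Matrix (Fin k × κ) κ ℂ := fun p b => L p.1 p.2 b
  have hW := hΦ.compPos k _ (hS.mul_mul_conjTranspose_same K)
  have e : ∀ p q, idTensor Φ (K * S * Kᴴ) p q = Φ (M p.1 * S * (M q.1)ᴴ) p.2 q.2 :=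
    fun _ _ => rfl
  generalize idTensor Φ (K * S * Kᴴ) = W at hW e
  have h := (hW.conjTranspose_mul_mul_same J).re_trace_nonneg
  rw [Matrix.mul_assoc, trace_mul_comm, Matrix.mul_assoc] at h
  convert h using 1
  simp only [← Complex.re_sum]
  congr 1
  simp only [trace, diag_apply, Matrix.mul_apply (M := W), e, Fintype.sum_prod_type,
    Matrix.mul_apply (M := Φ _)]
  refine Finset.sum_congr rfl fun p _ => ?_
  rw [Finset.sum_comm]
  rfl

lemma IsChannel.map_posSemidef {ι κ : Type} [Fintype ι] [Fintype κ]
    {Φ : Matrix ι ι ℂ → Matrix κ κ ℂ} (hΦ : IsChannel Φ) {S : Matrix ι ι ℂ}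
    (hS : S.PosSemidef) : (Φ S).PosSemidef :=
  (hΦ.compPos 1 _ (hS.submatrix Prod.snd)).submatrix fun b => (0, b)

lemma IsChannel.map_conjTranspose {ι κ : Type} [Fintype ι] [Fintype κ]
    {Φ : Matrix ι ι ℂ → Matrix κ κ ℂ} (hΦ : IsChannel Φ) (A : Matrix ι ι ℂ) :
    Φ Aᴴ = (Φ A)ᴴ := by
  let K : Matrix (Fin 2 × ι) ι ℂ := fun p b => (![A, 1] p.1) p.2 b
  have hW := (hΦ.compPos 2 _ (posSemidef_self_mul_conjTranspose K)).isHermitian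
  have e : ∀ p q, idTensor Φ (K * Kᴴ) p q = Φ (![A, 1] p.1 * (![A, 1] q.1)ᴴ) p.2 q.2 :=
    fun _ _ => rfl
  ext a b
  have := hW.apply ((1 : Fin 2), a) ((0 : Fin 2), b)
  rw [e, e] at this
  simpa using this.symm

/-- The adjoint of a channel with respect to the trace pairing. -/
lemma IsChannel.exists_dual {ι κ : Type} [Fintype ι] [Fintype κ]
    {Φ : Matrix ι ι ℂ → Matrix κ κ ℂ} (hΦ : IsChannel Φ) (X : Matrix κ κ ℂ) :
    ∃ Z : Matrix ι ι ℂ, ∀ S, (Φ S * X).trace = (S * Z).trace := by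
  let f : Matrix ι ι ℂ →ₗ[ℂ] ℂ :=
    (traceLinearMap κ ℂ ℂ) ∘ₗ (LinearMap.mulRight ℂ X) ∘ₗ hΦ.linear.mk'
  refine ⟨fun b a => f (single a b 1), fun S => ?_⟩
  change f S = _
  conv_lhs => rw [matrix_eq_sum_single S]
  simp only [map_sum, trace, diag_apply]
  refine Finset.sum_congr rfl fun a _ => Finset.sum_congr rfl fun b _ => ?_
  rw [show single a b (S a b) = S a b • single a b (1 : ℂ) by simp, map_smul, smul_eq_mul]

lemma IsChannel.re_trace_dual_le {ι κ : Type} [Fintype ι] [Fintype κ]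
    {Φ : Matrix ι ι ℂ → Matrix κ κ ℂ} (hΦ : IsChannel Φ) {X : Matrix κ κ ℂ} {Z : Matrix ι ι ℂ}
    (h : ∀ S, (Φ S * X).trace = (S * Z).trace) (h' : ∀ S, (Φ S * Xᴴ).trace = (S * Zᴴ).trace)
    {S : Matrix ι ι ℂ} (hS : S.PosSemidef) :
    (S * (Z * Zᴴ)).trace.re ≤ (Φ S * (X * Xᴴ)).trace.re := by
  have := hΦ.sum_re_trace_nonneg ![1, Zᴴ] ![X, -1] hS
  simp only [Fin.sum_univ_two, cons_val_zero, cons_val_one, Matrix.one_mul, conjTranspose_one,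
    Matrix.mul_one, conjTranspose_conjTranspose, conjTranspose_neg, Matrix.mul_neg,
    Matrix.neg_mul, trace_neg, Complex.neg_re, h, h', hΦ.tracePres] at this
  have e1 : (S * Z * Zᴴ).trace = (S * (Z * Zᴴ)).trace := by rw [Matrix.mul_assoc]
  have e2 : (Zᴴ * S * Z).trace = (S * (Z * Zᴴ)).trace := by
    rw [Matrix.mul_assoc, trace_mul_comm, Matrix.mul_assoc]
  rw [e1, e2] at this
  linarith

/-- Data processing for the variational form. -/
lemma IsChannel.varSup_le {ι κ : Type} [Fintype ι] [Fintype κ]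
    {Φ : Matrix ι ι ℂ → Matrix κ κ ℂ} (hΦ : IsChannel Φ) {t : ℝ} (ht : 0 ≤ t)
    {ρ σ : Matrix ι ι ℂ} (hρ : ρ.PosSemidef) (hσ : σ.PosSemidef) :
    varSup t (Φ ρ) (Φ σ) ≤ varSup t ρ σ := by
  refine iSup_le fun X => ?_
  obtain ⟨Z, h⟩ := hΦ.exists_dual X
  have h' : ∀ S, (Φ S * Xᴴ).trace = (S * Zᴴ).trace := by
    intro S
    have := congrArg star (h Sᴴ)
    rw [hΦ.map_conjTranspose, ← trace_conjTranspose, ← trace_conjTranspose, conjTranspose_mul,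
      conjTranspose_mul, conjTranspose_conjTranspose, conjTranspose_conjTranspose] at this
    rw [trace_mul_comm, this, trace_mul_comm]
  refine le_trans (ENNReal.ofReal_le_ofReal ?_) (le_varSup t ρ σ Z)
  have h1 := hΦ.re_trace_dual_le h h' hρ
  have h2 := hΦ.re_trace_dual_le (X := Xᴴ) (Z := Zᴴ) h'
    (by simpa only [conjTranspose_conjTranspose] using h) hσ
  rw [conjTranspose_conjTranspose, conjTranspose_conjTranspose] at h2
  rw [varForm, varForm, h]
  have := mul_le_mul_of_nonneg_left h2 ht
  linarith

lemma varSup_self_le {ι : Type} [Fintype ι] {t : ℝ} (ht : 0 ≤ t) {ρ : Matrix ι ι ℂ}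
    (hρ : IsDensity ρ) : varSup t ρ ρ ≤ ENNReal.ofReal (1 / (1 + t)) := by
  refine iSup_le fun X => ENNReal.ofReal_le_ofReal ?_
  have key : ∀ (Y : Matrix ι ι ℂ) (y : ℝ),
      0 ≤ (ρ * (Y * Yᴴ)).trace.re - 2 * y * (ρ * Y).trace.re + y ^ 2 := by
    intro Y y
    have hc : (ρ * Yᴴ).trace.re = (ρ * Y).trace.re := by
      rw [← Complex.conj_re, ← Complex.star_def, ← trace_conjTranspose, conjTranspose_mul,
        conjTranspose_conjTranspose, hρ.1.isHermitian.eq, trace_mul_comm]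
    have h := hρ.1.re_trace_mul_nonneg (posSemidef_self_mul_conjTranspose (Y - (y : ℂ) • 1))
    have e : (ρ * ((Y - (y : ℂ) • 1) * (Y - (y : ℂ) • 1)ᴴ)).trace =
        (ρ * (Y * Yᴴ)).trace - y * (ρ * Y).trace - y * (ρ * Yᴴ).trace + y ^ 2 * ρ.trace := by
      simp only [conjTranspose_sub, conjTranspose_smul, conjTranspose_one, Complex.star_def,
        Complex.conj_ofReal, Matrix.sub_mul, Matrix.mul_sub, Matrix.smul_mul, Matrix.mul_smul,
        Matrix.one_mul, Matrix.mul_one, trace_sub, trace_smul, smul_eq_mul]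
      ring
    rw [e, hρ.2, mul_one, ← Complex.ofReal_pow, Complex.add_re, Complex.sub_re, Complex.sub_re,
      Complex.re_ofReal_mul, Complex.re_ofReal_mul, Complex.ofReal_re, hc] at h
    linarith
  have hc : (ρ * Xᴴ).trace.re = (ρ * X).trace.re := by
    rw [← Complex.conj_re, ← Complex.star_def, ← trace_conjTranspose, conjTranspose_mul,
      conjTranspose_conjTranspose, hρ.1.isHermitian.eq, trace_mul_comm]
  have h1 := key X (1 / (1 + t))
  have h2 := key Xᴴ (1 / (1 + t))
  rw [conjTranspose_conjTranspose, hc] at h2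
  have h3 := mul_nonneg ht h2
  have ht1 : (1 + t) * (1 / (1 + t)) = 1 := mul_one_div_cancel (by positivity)
  rw [varForm]
  set y := 1 / (1 + t)
  set z := (ρ * X).trace.re
  have e1 : (1 + t) * y * z = z := by rw [ht1, one_mul]
  have e2 : (1 + t) * y * y = y := by rw [ht1, one_mul]
  nlinarith

lemma le_varSup_test {ι : Type} [Fintype ι] [DecidableEq ι] {t b : ℝ} (ht : 0 ≤ t)
    {S T Q : Matrix ι ι ℂ} (hS : S.PosSemidef) (hT : T.PosSemidef) (hQ : Q.PosSemidef)
    (hQ1 : (1 - Q).PosSemidef) (ha : 0 < (Q * S).trace.re) (hb : (Q * T).trace.re ≤ b)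
    (hb0 : 0 ≤ b) :
    ENNReal.ofReal ((Q * S).trace.re * (1 / (1 + t * (b / (Q * S).trace.re)))) ≤
      varSup t S T := by
  set a := (Q * S).trace.re with ha'
  set x : ℝ := 1 / (1 + t * (b / a)) with hx
  refine le_trans (ENNReal.ofReal_le_ofReal ?_) (le_varSup t S T ((x : ℂ) • Q))
  have h1 := re_trace_mul_mul_le hQ hQ1 hS
  have h2 := (re_trace_mul_mul_le hQ hQ1 hT).trans hb
  have e : ∀ R : Matrix ι ι ℂ, (R * (Q * Q)).trace = (Q * R * Q).trace := by
    intro R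
    rw [← Matrix.mul_assoc, trace_mul_comm, ← Matrix.mul_assoc]
  have hx0 : 0 < 1 + t * (b / a) := by positivity
  simp only [varForm, conjTranspose_smul, Complex.star_def, Complex.conj_ofReal, hQ.isHermitian.eq,
    Matrix.smul_mul, Matrix.mul_smul, trace_smul, smul_eq_mul, Complex.re_ofReal_mul, e]
  rw [trace_mul_comm S Q, ← ha']
  have hxx : x * (a + t * b) = a := by
    rw [hx]; field_simp
  have h3 : x * (x * (Q * S * Q).trace.re) ≤ x * (x * a) := by
    rw [← mul_assoc, ← mul_assoc]
    exact mul_le_mul_of_nonneg_left h1 (mul_self_nonneg x)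
  have h4 : t * (x * (x * (Q * T * Q).trace.re)) ≤ t * (x * (x * b)) := by
    refine mul_le_mul_of_nonneg_left ?_ ht
    rw [← mul_assoc, ← mul_assoc]
    exact mul_le_mul_of_nonneg_left h2 (mul_self_nonneg x)
  have h5 : x * (x * (a + t * b)) = x * a := by rw [hxx]
  nlinarith

end VariationalForm

section ClassicalQuantumStep

open Matrix Kronecker

/-- The `(i, j)` block of a matrix on `R ⊗ B`. -/
abbrev blk {R B : Type} (Y : Matrix (R × B) (R × B) ℂ) (i j : B) : Matrix R R ℂ :=
  Y.submatrix (fun r => (r, i)) fun r => (r, j)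

variable {R B : Type} [Fintype R] [Fintype B]

lemma blk_mul (Y Z : Matrix (R × B) (R × B) ℂ) (i k : B) :
    blk (Y * Z) i k = ∑ j, blk Y i j * blk Z j k := by
  ext r s
  simp only [submatrix_apply, Matrix.mul_apply, Matrix.sum_apply, Fintype.sum_prod_type]
  exact Finset.sum_comm

lemma trace_kronecker_diagonal_mul [DecidableEq B] (P : Matrix R R ℂ) (d : B → ℂ)
    (M : Matrix (R × B) (R × B) ℂ) :
    ((P ⊗ₖ diagonal d) * M).trace = ∑ i, d i * (P * blk M i i).trace := by
  simp only [trace, diag_apply, Matrix.mul_apply, Fintype.sum_prod_type, kroneckerMap_apply,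
    submatrix_apply, diagonal_apply, mul_ite, mul_zero, ite_mul, zero_mul, Finset.sum_ite_eq,
    Finset.mem_univ, if_true]
  rw [Finset.sum_comm]
  refine Finset.sum_congr rfl fun i _ => ?_
  rw [Finset.mul_sum]
  refine Finset.sum_congr rfl fun r _ => ?_
  rw [Finset.mul_sum]
  exact Finset.sum_congr rfl fun s _ => by ring

lemma ofReal_sum_le {α : Type} [Fintype α] (f : α → ℝ) :
    ENNReal.ofReal (∑ i, f i) ≤ ∑ i, ENNReal.ofReal (f i) :=
  Finset.le_sum_of_subadditive ENNReal.ofReal ENNReal.ofReal_zero.le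
    (fun _ _ => ENNReal.ofReal_add_le) _ _

/-- Block expansion of the variational form on product matrices, in eigenbases of the second
factors. -/
lemma varForm_kronecker_eq [DecidableEq R] [DecidableEq B] (t : ℝ) (ρ σ : Matrix R R ℂ)
    {ν μ U V : Matrix B B ℂ} {a b : B → ℝ} (hν : IsSpectral ν U a) (hμ : IsSpectral μ V b)
    (Y : Matrix (R × B) (R × B) ℂ) :
    ∃ Z : B → B → Matrix R R ℂ, varForm t (ρ ⊗ₖ ν) (σ ⊗ₖ μ) Y =
      ∑ i, ∑ j, (2 * (a i * (star ((Uᴴ * V) i j) * (ρ * Z i j).trace).re) -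
        a i * (ρ * (Z i j * (Z i j)ᴴ)).trace.re -
        t * (b j * (σ * ((Z i j)ᴴ * Z i j)).trace.re)) := by
  set UU : Matrix (R × B) (R × B) ℂ := 1 ⊗ₖ U with hUU
  set VV : Matrix (R × B) (R × B) ℂ := 1 ⊗ₖ V with hVV
  set Y' := UUᴴ * Y * VV with hY'
  have hU1 : UU * UUᴴ = 1 := by
    rw [hUU, conjTranspose_kronecker, ← mul_kronecker_mul, hν.mul_star]; simp
  have hV1 : VV * VVᴴ = 1 := by
    rw [hVV, conjTranspose_kronecker, ← mul_kronecker_mul, hμ.mul_star]; simp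
  have conj : ∀ (P : Matrix R R ℂ) (W D : Matrix B B ℂ),
      P ⊗ₖ (W * D * Wᴴ) = (1 ⊗ₖ W) * (P ⊗ₖ D) * (1 ⊗ₖ W)ᴴ := by
    intro P W D
    rw [conjTranspose_kronecker, ← mul_kronecker_mul, ← mul_kronecker_mul]
    simp
  have cyc : ∀ P Q W M : Matrix (R × B) (R × B) ℂ,
      (W * P * Q * M).trace = (P * (Q * M * W)).trace := by
    intro P Q W M
    rw [Matrix.mul_assoc, Matrix.mul_assoc, trace_mul_comm]
    simp only [Matrix.mul_assoc]
  have e1 : UUᴴ * Y * UU = Y' * (VVᴴ * UU) := by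
    rw [hY', Matrix.mul_assoc (UUᴴ * Y), ← Matrix.mul_assoc VV, hV1, Matrix.one_mul]
  have e2 : UUᴴ * (Y * Yᴴ) * UU = Y' * Y'ᴴ := by
    rw [hY', conjTranspose_mul, conjTranspose_mul, conjTranspose_conjTranspose,
      Matrix.mul_assoc (UUᴴ * Y), ← Matrix.mul_assoc VV, hV1, Matrix.one_mul]
    simp only [Matrix.mul_assoc]
  have e3 : VVᴴ * (Yᴴ * Y) * VV = Y'ᴴ * Y' := by
    rw [hY', conjTranspose_mul, conjTranspose_mul, conjTranspose_conjTranspose,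
      show ∀ c d f g h : Matrix (R × B) (R × B) ℂ, c * (d * f) * (g * h * VV) =
        c * (d * (f * g) * h) * VV by intros; simp only [Matrix.mul_assoc], hU1, Matrix.mul_one]
  have e4 : ∀ i j, blk (VVᴴ * UU) j i = star ((Uᴴ * V) i j) • (1 : Matrix R R ℂ) := by
    intro i j
    rw [hVV, hUU, conjTranspose_kronecker, ← mul_kronecker_mul, ← conjTranspose_apply,
      conjTranspose_mul, conjTranspose_conjTranspose]
    ext r s
    simp [mul_comm]
  refine ⟨blk Y', ?_⟩
  rw [varForm, hν.eq, hμ.eq, conj, conj, cyc, cyc, cyc, e1, e2, e3, trace_kronecker_diagonal_mul,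
    trace_kronecker_diagonal_mul, trace_kronecker_diagonal_mul]
  simp only [blk_mul, e4, trace_sum, Matrix.mul_smul, Matrix.mul_one, trace_smul,
    smul_eq_mul, Complex.re_sum, Complex.re_ofReal_mul, Finset.mul_sum, Finset.sum_sub_distrib]
  congr 1
  rw [Finset.sum_comm]
  rfl

lemma varSup_kronecker_le [DecidableEq R] [DecidableEq B] {t : ℝ} (ht : 0 ≤ t)
    {ρ σ : Matrix R R ℂ} (hρ : ρ.PosSemidef) (hσ : σ.PosSemidef) {ν μ U V : Matrix B B ℂ}
    {a b : B → ℝ} (hν : IsSpectral ν U a) (hμ : IsSpectral μ V b) :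
    varSup t (ρ ⊗ₖ ν) (σ ⊗ₖ μ) ≤
      ∑ i, ∑ j, ENNReal.ofReal (overlap U V i j * a i) * varSup (t * (b j / a i)) ρ σ := by
  refine iSup_le fun Y => ?_
  obtain ⟨Z, hZ⟩ := varForm_kronecker_eq t ρ σ hν hμ Y
  rw [hZ]
  have term : ∀ i j, ENNReal.ofReal (2 * (a i * (star ((Uᴴ * V) i j) * (ρ * Z i j).trace).re) -
      a i * (ρ * (Z i j * (Z i j)ᴴ)).trace.re - t * (b j * (σ * ((Z i j)ᴴ * Z i j)).trace.re)) ≤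
      ENNReal.ofReal (overlap U V i j * a i) * varSup (t * (b j / a i)) ρ σ := by
    intro i j
    have h1 := hρ.re_trace_mul_nonneg (posSemidef_self_mul_conjTranspose (Z i j))
    have h2 := hσ.re_trace_mul_nonneg (posSemidef_conjTranspose_mul_self (Z i j))
    have ha := hν.nonneg i
    have hb := hμ.nonneg j
    have h3 := mul_nonneg ha h1
    have h4 := mul_nonneg ht (mul_nonneg hb h2)
    by_cases ha0 : a i = 0
    · rw [ENNReal.ofReal_of_nonpos]
      · exact zero_le
      · rw [ha0] at *; linarith
    by_cases hc : (Uᴴ * V) i j = 0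
    · rw [ENNReal.ofReal_of_nonpos]
      · exact zero_le
      · rw [hc, star_zero, zero_mul, Complex.zero_re]; linarith
    set c := (Uᴴ * V) i j with hcdef
    have hw : 0 ≤ overlap U V i j * a i := mul_nonneg (Complex.normSq_nonneg _) ha
    refine le_trans (le_of_eq ?_) (mul_le_mul_right (le_varSup _ ρ σ (c⁻¹ • Z i j)) _)
    rw [← ENNReal.ofReal_mul hw]
    congr 1
    have hn : Complex.normSq c ≠ 0 := by simpa using hc
    have es : star c = (Complex.normSq c : ℂ) * c⁻¹ := by
      rw [Complex.star_def, Complex.normSq_eq_conj_mul_self, mul_assoc, mul_inv_cancel₀ hc, mul_one]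
    have en : c⁻¹ * star c⁻¹ = ((Complex.normSq c)⁻¹ : ℝ) := by
      rw [Complex.star_def, Complex.mul_conj, Complex.normSq_inv]
    simp only [varForm, conjTranspose_smul, smul_mul_smul_comm, Matrix.mul_smul, trace_smul, en,
      mul_comm (star c⁻¹), smul_eq_mul, Complex.re_ofReal_mul]
    rw [es, mul_assoc, Complex.re_ofReal_mul, overlap, ← hcdef]
    field_simp
  refine (ofReal_sum_le _).trans (Finset.sum_le_sum fun i _ => ?_)
  exact (ofReal_sum_le _).trans (Finset.sum_le_sum fun j _ => term i j)

lemma varSup_sum_le {ι X : Type} [Fintype ι] [Fintype X] (t : ℝ) (ρ σ : X → Matrix ι ι ℂ) :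
    varSup t (∑ x, ρ x) (∑ x, σ x) ≤ ∑ x, varSup t (ρ x) (σ x) := by
  refine iSup_le fun Y => ?_
  have e : varForm t (∑ x, ρ x) (∑ x, σ x) Y = ∑ x, varForm t (ρ x) (σ x) Y := by
    simp only [varForm, Matrix.sum_mul, trace_sum, Complex.re_sum, Finset.mul_sum,
      Finset.sum_sub_distrib]
  rw [e]
  exact (ofReal_sum_le _).trans (Finset.sum_le_sum fun x _ => le_varSup t _ _ Y)

lemma varForm_blockDiagonal [DecidableEq B] (t : ℝ) (ρ σ : Matrix (R × B) (R × B) ℂ)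
    (Y : B → Matrix R R ℂ) :
    varForm t ρ σ (blockDiagonal Y) = ∑ x, varForm t (blk ρ x x) (blk σ x x) (Y x) := by
  have e : ∀ (P : Matrix (R × B) (R × B) ℂ) (M : B → Matrix R R ℂ),
      (P * blockDiagonal M).trace = ∑ x, (blk P x x * M x).trace := by
    intro P M
    simp only [trace, diag_apply, Matrix.mul_apply, Fintype.sum_prod_type, blockDiagonal_apply,
      submatrix_apply, mul_ite, mul_zero, Finset.sum_ite_eq', Finset.mem_univ, if_true]
    exact Finset.sum_comm
  simp only [varForm, blockDiagonal_conjTranspose, ← blockDiagonal_mul, e, Complex.re_sum,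
    Finset.mul_sum, Finset.sum_sub_distrib]

/-- Dephasing the second factor does not increase the variational form. -/
lemma sum_varSup_blk_le [DecidableEq B] (t : ℝ) (ρ σ : Matrix (R × B) (R × B) ℂ) :
    ∑ x, varSup t (blk ρ x x) (blk σ x x) ≤ varSup t ρ σ := by
  set g : B → Matrix R R ℂ → ℝ := fun x => varForm t (blk ρ x x) (blk σ x x) with hg
  have e : ∀ x, varSup t (blk ρ x x) (blk σ x x) =
      ⨆ Y : B → Matrix R R ℂ, ENNReal.ofReal (g x (Y x)) := by
    intro x
    exact (Function.Surjective.iSup_comp (f := fun Y : B → Matrix R R ℂ => Y x)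
      (fun Z => ⟨fun _ => Z, rfl⟩) fun Z => ENNReal.ofReal (g x Z)).symm
  simp only [e]
  rw [ENNReal.finsetSum_iSup]
  · refine iSup_le fun Y => ?_
    set Y' : B → Matrix R R ℂ := fun x => if 0 ≤ g x (Y x) then Y x else 0 with hY'
    have h : ∀ x, ENNReal.ofReal (g x (Y x)) = ENNReal.ofReal (g x (Y' x)) ∧ 0 ≤ g x (Y' x) := by
      intro x
      rcases le_or_gt 0 (g x (Y x)) with hx | hx
      · rw [hY']; dsimp only; rw [if_pos hx]
        exact ⟨rfl, hx⟩
      · rw [hY']; dsimp only; rw [if_neg hx.not_ge, ENNReal.ofReal_of_nonpos hx.le, hg]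
        simp [varForm_zero]
    simp only [(h _).1]
    rw [← ENNReal.ofReal_sum_of_nonneg fun x _ => (h x).2, hg, ← varForm_blockDiagonal]
    exact le_varSup t ρ σ _
  · intro Y Z
    refine ⟨fun x => if g x (Y x) ≤ g x (Z x) then Z x else Y x, fun x => ?_⟩
    by_cases hx : g x (Y x) ≤ g x (Z x)
    · simp only [hx, if_true]
      exact ⟨ENNReal.ofReal_le_ofReal hx, le_rfl⟩
    · simp only [hx, if_false]
      exact ⟨le_rfl, ENNReal.ofReal_le_ofReal (not_le.mp hx).le⟩

end ClassicalQuantumStep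

section IntegratedForm

open Matrix Kronecker MeasureTheory

/-- Integration against `t ^ (s - 1) dt` over the positive reals. -/
def mellin₀ (s : ℝ) (F : ℝ → ENNReal) : ENNReal :=
  ∫⁻ t in Set.Ioi (0 : ℝ), ENNReal.ofReal (t ^ (s - 1)) * F t

lemma mellin₀_mono {s : ℝ} {F G : ℝ → ENNReal} (h : ∀ t, 0 < t → F t ≤ G t) :
    mellin₀ s F ≤ mellin₀ s G :=
  setLIntegral_mono' measurableSet_Ioi fun t ht => mul_le_mul_right (h t ht) _

lemma mellin₀_const_mul {s : ℝ} {F : ℝ → ENNReal} (hF : Measurable F) (c : ENNReal) :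
    mellin₀ s (fun t => c * F t) = c * mellin₀ s F := by
  rw [mellin₀, mellin₀, ← lintegral_const_mul _ (by fun_prop)]
  simp only [mul_left_comm]

lemma mellin₀_sum {s : ℝ} {α : Type} [Fintype α] {F : α → ℝ → ENNReal}
    (hF : ∀ i, Measurable (F i)) :
    mellin₀ s (fun t => ∑ i, F i t) = ∑ i, mellin₀ s (F i) := by
  simp only [mellin₀, Finset.mul_sum]
  exact lintegral_finsetSum _ fun i _ => by have := hF i; fun_prop

lemma mellin₀_comp_mul {s c : ℝ} (hc : 0 < c) {F : ℝ → ENNReal} (hF : Measurable F) :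
    mellin₀ s (fun t => F (t * c)) = ENNReal.ofReal (c ^ (-s)) * mellin₀ s F := by
  have h1 : ∫⁻ t in Set.Ioi (0 : ℝ), ENNReal.ofReal (t ^ (s - 1)) * F t =
      ENNReal.ofReal c * ∫⁻ t in Set.Ioi (0 : ℝ), ENNReal.ofReal ((t * c) ^ (s - 1)) * F (t * c) := by
    rw [← lintegral_indicator measurableSet_Ioi, ← lintegral_indicator measurableSet_Ioi]
    conv_lhs => rw [← Real.smul_map_volume_mul_right hc.ne', lintegral_smul_measure]
    rw [lintegral_map (by measurability) (by fun_prop), abs_of_pos hc, smul_eq_mul]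
    congr 2
    ext t
    simp [Set.indicator, hc]
  have h2 : ∫⁻ t in Set.Ioi (0 : ℝ), ENNReal.ofReal ((t * c) ^ (s - 1)) * F (t * c) =
      ENNReal.ofReal (c ^ (s - 1)) * mellin₀ s (fun t => F (t * c)) := by
    rw [mellin₀, ← lintegral_const_mul _ (by fun_prop)]
    refine setLIntegral_congr_fun measurableSet_Ioi fun t ht => ?_
    rw [Real.mul_rpow (le_of_lt ht) hc.le, mul_comm (t ^ _), ENNReal.ofReal_mul (by positivity),
      mul_assoc]
  rw [show mellin₀ s F = _ from h1, h2, ← mul_assoc, ← mul_assoc, ← ENNReal.ofReal_mul (by positivity),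
    ← ENNReal.ofReal_mul (by positivity)]
  rw [Real.rpow_sub_one hc.ne', Real.rpow_neg hc.le]
  have : (c ^ s)⁻¹ * c * (c ^ s / c) = 1 := by
    have := (Real.rpow_pos_of_pos hc s).ne'
    field_simp
  rw [this, ENNReal.ofReal_one, one_mul]

lemma mellin₀_inv_pos_lt_top {s : ℝ} (hs0 : 0 < s) (hs1 : s < 1) :
    0 < mellin₀ s (fun t => ENNReal.ofReal (1 / (1 + t))) ∧
      mellin₀ s (fun t => ENNReal.ofReal (1 / (1 + t))) < ⊤ := by
  have e : mellin₀ s (fun t => ENNReal.ofReal (1 / (1 + t))) =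
      ∫⁻ t in Set.Ioi (0 : ℝ), ENNReal.ofReal (Real.rpowIntegrand₀₁ s t 1) := by
    refine setLIntegral_congr_fun measurableSet_Ioi fun t ht => ?_
    simp only
    rw [Real.rpowIntegrand₀₁_eq_pow_div ⟨hs0, hs1⟩ (le_of_lt ht) zero_le_one,
      ← ENNReal.ofReal_mul (Real.rpow_nonneg (le_of_lt ht) _), mul_one_div, mul_one, add_comm]
  constructor
  · rw [mellin₀, setLIntegral_pos_iff (by fun_prop)]
    have : Function.support (fun t : ℝ =>
        ENNReal.ofReal (t ^ (s - 1)) * ENNReal.ofReal (1 / (1 + t))) ∩ Set.Ioi 0 = Set.Ioi 0 := by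
      refine Set.inter_eq_right.mpr fun t ht => ?_
      have ht' : (0 : ℝ) < t := ht
      have h1 : 0 < t ^ (s - 1) := Real.rpow_pos_of_pos ht' _
      have h2 : 0 < 1 / (1 + t) := by positivity
      simp only [Function.mem_support, ne_eq, mul_eq_zero, ENNReal.ofReal_eq_zero, not_or, not_le]
      exact ⟨h1, h2⟩
    rw [this]
    simp
  · rw [e]
    exact (Real.integrableOn_rpowIntegrand₀₁_Ioi ⟨hs0, hs1⟩ zero_le_one).setLIntegral_lt_top

end IntegratedForm

section StrongConverse

open Matrix Kronecker

lemma mellin₀_varSup_kronecker_le {R B : Type} [Fintype R] [DecidableEq R] [Fintype B]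
    [DecidableEq B] (s : ℝ) {ρ σ : Matrix R R ℂ} (hρ : ρ.PosSemidef) (hσ : σ.PosSemidef)
    {ν μ U V : Matrix B B ℂ} {a b : B → ℝ} (hν : IsSpectral ν U a) (hμ : IsSpectral μ V b)
    (hs : suppLE ν μ) :
    mellin₀ s (fun t => varSup t (ρ ⊗ₖ ν) (σ ⊗ₖ μ)) ≤
      ENNReal.ofReal (overlapSum (overlap U V) a b s) * mellin₀ s (fun t => varSup t ρ σ) := by
  have hm := measurable_varSup ρ σ
  have hm' : ∀ c : ℝ, Measurable fun t => varSup (t * c) ρ σ := fun c =>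
    hm.comp (measurable_id.mul_const c)
  refine (mellin₀_mono fun t ht => varSup_kronecker_le ht.le hρ hσ hν hμ).trans ?_
  rw [mellin₀_sum fun i => Finset.measurable_sum _ fun j _ => (hm' _).const_mul _]
  have nn : ∀ i j, 0 ≤ overlap U V i j *
      if a i = 0 ∨ b j = 0 then 0 else a i ^ (1 + s) * b j ^ (-s) := by
    intro i j
    refine mul_nonneg (Complex.normSq_nonneg _) ?_
    split_ifs
    · exact le_rfl
    · exact mul_nonneg (Real.rpow_nonneg (hν.nonneg i) _) (Real.rpow_nonneg (hμ.nonneg j) _)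
  rw [overlapSum, ENNReal.ofReal_sum_of_nonneg fun i _ => Finset.sum_nonneg fun j _ => nn i j,
    Finset.sum_mul]
  refine Finset.sum_le_sum fun i _ => ?_
  rw [mellin₀_sum fun j => (hm' _).const_mul _, ENNReal.ofReal_sum_of_nonneg fun j _ => nn i j,
    Finset.sum_mul]
  refine Finset.sum_le_sum fun j _ => ?_
  rw [mellin₀_const_mul (hm' _)]
  by_cases ha : a i = 0
  · simp [ha]
  by_cases hb : b j = 0
  · simp [(hν.suppLE_iff hμ).mp hs i j hb]
  have ha' := (hν.nonneg i).lt_of_ne' ha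
  have hb' := (hμ.nonneg j).lt_of_ne' hb
  rw [mellin₀_comp_mul (div_pos hb' ha') hm, ← mul_assoc,
    ← ENNReal.ofReal_mul (mul_nonneg (Complex.normSq_nonneg _) ha'.le :
      0 ≤ overlap U V i j * a i), if_neg (by tauto)]
  refine le_of_eq ?_
  congr 2
  rw [Real.div_rpow hb'.le ha'.le, Real.rpow_add ha', Real.rpow_one, Real.rpow_neg ha'.le]
  field_simp

lemma Matrix.PosSemidef.idTensor_cqChannel {R X B : Type} [Fintype R] [Fintype X] [Fintype B]
    {ν : X → Matrix B B ℂ} (hν : ∀ x, IsDensity (ν x)) {ρ : Matrix (R × X) (R × X) ℂ}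
    (hρ : ρ.PosSemidef) : (idTensor (cqChannel ν) ρ).PosSemidef := by
  rw [_root_.idTensor_cqChannel]
  exact posSemidef_sum _ fun x _ => (hρ.submatrix _).kronecker (hν x).1

lemma trace_idTensor_cqChannel {R X B : Type} [Fintype R] [Fintype X] [Fintype B]
    {ν : X → Matrix B B ℂ} (hν : ∀ x, IsDensity (ν x)) (ρ : Matrix (R × X) (R × X) ℂ) :
    (idTensor (cqChannel ν) ρ).trace = ρ.trace := by
  rw [idTensor_cqChannel, trace_sum]
  simp only [trace_kronecker, (hν _).2, mul_one]
  simp only [trace, diag_apply, submatrix_apply, Fintype.sum_prod_type]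
  exact Finset.sum_comm

/-- One use of the classical-quantum channels multiplies the integrated variational form by at
most the largest spectral overlap. -/
lemma mellin₀_varSup_idTensor_le {R X B : Type} [Fintype R] [DecidableEq R] [Fintype X]
    [DecidableEq X] [Fintype B] [DecidableEq B] {s K : ℝ} {ν μ : X → Matrix B B ℂ}
    {U V : X → Matrix B B ℂ} {a b : X → B → ℝ} (hU : ∀ x, IsSpectral (ν x) (U x) (a x))
    (hV : ∀ x, IsSpectral (μ x) (V x) (b x)) (hs : ∀ x, suppLE (ν x) (μ x))
    (hK : ∀ x, overlapSum (overlap (U x) (V x)) (a x) (b x) s ≤ K)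
    {ρ σ : Matrix (R × X) (R × X) ℂ} (hρ : ρ.PosSemidef) (hσ : σ.PosSemidef) :
    mellin₀ s (fun t => varSup t (idTensor (cqChannel ν) ρ) (idTensor (cqChannel μ) σ)) ≤
      ENNReal.ofReal K * mellin₀ s (fun t => varSup t ρ σ) := by
  rw [idTensor_cqChannel, idTensor_cqChannel]
  calc _ ≤ mellin₀ s fun t => ∑ x, varSup t (blk ρ x x ⊗ₖ ν x) (blk σ x x ⊗ₖ μ x) :=
        mellin₀_mono fun t _ => varSup_sum_le t _ _
    _ = ∑ x, mellin₀ s fun t => varSup t (blk ρ x x ⊗ₖ ν x) (blk σ x x ⊗ₖ μ x) :=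
        mellin₀_sum fun x => measurable_varSup _ _
    _ ≤ ∑ x, ENNReal.ofReal K * mellin₀ s fun t => varSup t (blk ρ x x) (blk σ x x) := by
        refine Finset.sum_le_sum fun x _ => ?_
        refine (mellin₀_varSup_kronecker_le s (hρ.submatrix _) (hσ.submatrix _) (hU x) (hV x)
          (hs x)).trans ?_
        gcongr
        exact hK x
    _ = ENNReal.ofReal K * mellin₀ s fun t => ∑ x, varSup t (blk ρ x x) (blk σ x x) := by
        rw [mellin₀_sum fun x => measurable_varSup _ _, Finset.mul_sum]
    _ ≤ _ := by
        gcongr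
        exact mellin₀_mono fun t _ => sum_varSup_blk_le t ρ σ

section Evolution

variable {X B : Type} [Fintype X] [DecidableEq X] [Fintype B] [DecidableEq B] {m : ℕ}

lemma Protocol.isDensity_evolve (P : Protocol X B m) {ν : X → Matrix B B ℂ}
    (hν : ∀ x, IsDensity (ν x)) {i : ℕ} (hi : i ≤ m) :
    IsDensity (P.evolve (cqChannel ν) i) := by
  induction i with
  | zero => exact P.init_density
  | succ i ih =>
    have h := ih (Nat.le_of_succ_le hi)
    have hc := P.adapt_channel i hi
    refine ⟨hc.map_posSemidef (h.1.idTensor_cqChannel hν), ?_⟩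
    rw [Protocol.evolve, hc.tracePres, trace_idTensor_cqChannel hν, h.2]

lemma Protocol.mellin₀_varSup_evolve_le (P : Protocol X B m) {s K : ℝ} {ν μ : X → Matrix B B ℂ}
    (hν : ∀ x, IsDensity (ν x)) (hμ : ∀ x, IsDensity (μ x))
    {U V : X → Matrix B B ℂ} {a b : X → B → ℝ} (hU : ∀ x, IsSpectral (ν x) (U x) (a x))
    (hV : ∀ x, IsSpectral (μ x) (V x) (b x)) (hs : ∀ x, suppLE (ν x) (μ x))
    (hK : ∀ x, overlapSum (overlap (U x) (V x)) (a x) (b x) s ≤ K) {i : ℕ} (hi : i ≤ m) :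
    mellin₀ s (fun t => varSup t (P.evolve (cqChannel ν) i) (P.evolve (cqChannel μ) i)) ≤
      ENNReal.ofReal K ^ i * mellin₀ s (fun t => ENNReal.ofReal (1 / (1 + t))) := by
  induction i with
  | zero =>
    rw [pow_zero, one_mul]
    exact mellin₀_mono fun t ht => varSup_self_le ht.le P.init_density
  | succ i ih =>
    have hi' := Nat.le_of_succ_le hi
    have hρ := (P.isDensity_evolve hν hi').1
    have hσ := (P.isDensity_evolve hμ hi').1
    calc _ ≤ mellin₀ s (fun t => varSup t (idTensor (cqChannel ν) (P.evolve (cqChannel ν) i))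
          (idTensor (cqChannel μ) (P.evolve (cqChannel μ) i))) :=
          mellin₀_mono fun t ht => (P.adapt_channel i hi).varSup_le ht.le
            (hρ.idTensor_cqChannel hν) (hσ.idTensor_cqChannel hμ)
      _ ≤ ENNReal.ofReal K * mellin₀ s
          (fun t => varSup t (P.evolve (cqChannel ν) i) (P.evolve (cqChannel μ) i)) :=
          mellin₀_varSup_idTensor_le hU hV hs hK hρ hσ
      _ ≤ ENNReal.ofReal K * (ENNReal.ofReal K ^ i * _) := by gcongr; exact ih hi'
      _ = _ := by rw [pow_succ', mul_assoc]

lemma Protocol.acceptProb_eq (P : Protocol X B m) {ν : X → Matrix B B ℂ}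
    (hν : ∀ x, IsDensity (ν x)) :
    (P.meas * P.final (cqChannel ν)).trace.re = 1 - P.typeI (cqChannel ν) := by
  have h : (P.final (cqChannel ν)).trace = 1 := by
    rw [Protocol.final, trace_idTensor_cqChannel hν, (P.isDensity_evolve hν le_rfl).2]
  rw [Protocol.typeI, Matrix.sub_mul, trace_sub, Matrix.one_mul, Complex.sub_re, h, Complex.one_re]
  ring

/-- The strong converse bound for every protocol. -/
lemma Protocol.rpow_mul_rpow_neg_le (P : Protocol X B m) {s K : ℝ} (hs0 : 0 < s) (hs1 : s < 1)
    (hK0 : 0 ≤ K) {ν μ : X → Matrix B B ℂ}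
    (hν : ∀ x, IsDensity (ν x)) (hμ : ∀ x, IsDensity (μ x))
    {U V : X → Matrix B B ℂ} {a b : X → B → ℝ} (hU : ∀ x, IsSpectral (ν x) (U x) (a x))
    (hV : ∀ x, IsSpectral (μ x) (V x) (b x)) (hs : ∀ x, suppLE (ν x) (μ x))
    (hK : ∀ x, overlapSum (overlap (U x) (V x)) (a x) (b x) s ≤ K)
    {α β : ℝ} (hα : α = 1 - P.typeI (cqChannel ν)) (hα0 : 0 < α)
    (hβ : P.typeII (cqChannel μ) ≤ β) (hβ0 : 0 < β) :
    α * (β / α) ^ (-s) ≤ K ^ (m + 1) := by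
  obtain ⟨hI0, hI⟩ := mellin₀_inv_pos_lt_top hs0 hs1
  set I := mellin₀ s (fun t => ENNReal.ofReal (1 / (1 + t)))
  have hρ := (P.isDensity_evolve hν le_rfl).1
  have hσ := (P.isDensity_evolve hμ le_rfl).1
  rw [← P.acceptProb_eq hν] at hα
  have hm : Measurable fun t : ℝ => ENNReal.ofReal (1 / (1 + t)) := by fun_prop
  have h : ENNReal.ofReal (α * (β / α) ^ (-s)) * I ≤ ENNReal.ofReal (K ^ (m + 1)) * I := by
    calc ENNReal.ofReal (α * (β / α) ^ (-s)) * I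
        = mellin₀ s fun t => ENNReal.ofReal (α * (1 / (1 + t * (β / α)))) := by
          simp only [ENNReal.ofReal_mul hα0.le]
          rw [mellin₀_const_mul (by fun_prop),
            mellin₀_comp_mul (F := fun t => ENNReal.ofReal (1 / (1 + t))) (div_pos hβ0 hα0) hm,
            mul_assoc]
      _ ≤ mellin₀ s fun t => varSup t (P.final (cqChannel ν)) (P.final (cqChannel μ)) := by
          refine mellin₀_mono fun t ht => ?_
          have := le_varSup_test ht.le (hρ.idTensor_cqChannel hν) (hσ.idTensor_cqChannel hμ)
            P.meas_psd P.meas_le_one (hα ▸ hα0) hβ hβ0.le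
          rw [hα]
          exact this
      _ ≤ ENNReal.ofReal K * mellin₀ s
          (fun t => varSup t (P.evolve (cqChannel ν) m) (P.evolve (cqChannel μ) m)) :=
          mellin₀_varSup_idTensor_le hU hV hs hK hρ hσ
      _ ≤ ENNReal.ofReal K * (ENNReal.ofReal K ^ m * I) := by
          gcongr
          exact P.mellin₀_varSup_evolve_le hν hμ hU hV hs hK le_rfl
      _ = ENNReal.ofReal (K ^ (m + 1)) * I := by
          rw [← mul_assoc, ← pow_succ', ENNReal.ofReal_pow hK0]
  rw [ENNReal.mul_le_mul_iff_left hI0.ne' hI.ne, ENNReal.ofReal_le_ofReal_iff (by positivity)] at h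
  exact h

lemma eventually_steinExp_le {ν μ : X → Matrix B B ℂ} (hν : ∀ x, IsDensity (ν x))
    (hμ : ∀ x, IsDensity (μ x)) {r r' ε : ℝ} (hε : ε < 1)
    (hr : ∀ x, relEnt (ν x) (μ x) < (r : EReal)) (hrr : r < r') :
    ∀ᶠ m : ℕ in Filter.atTop, steinExp (cqChannel ν) (cqChannel μ) m ε ≤ r' := by
  choose U a hU using fun x => (hν x).1.exists_isSpectral
  choose V b hV using fun x => (hμ x).1.exists_isSpectral
  have hs : ∀ x, suppLE (ν x) (μ x) := by
    intro x
    by_contra h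
    have := hr x
    rw [relEnt, if_neg h] at this
    exact not_top_lt this
  have hev : ∀ᶠ u in nhdsWithin (0 : ℝ) (Set.Ioi 0),
      ∀ x, overlapSum (overlap (U x) (V x)) (a x) (b x) u < 2 ^ (r * u) :=
    Filter.eventually_all.mpr fun x =>
      (hU x).eventually_lt_of_relEnt_lt (hV x) (hν x).2 (hs x) (hr x)
  obtain ⟨s, hK, hs0, hs1⟩ := (hev.and (Ioo_mem_nhdsGT one_pos)).exists
  have hδ : 0 < 1 - ε := by linarith
  have hlim : ∀ᶠ m : ℕ in Filter.atTop,
      1 < (1 - ε) ^ (1 + s) * (2 ^ ((r' - r) * s)) ^ (m + 1) := by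
    have h1 : (1 : ℝ) < 2 ^ ((r' - r) * s) :=
      Real.one_lt_rpow one_lt_two (mul_pos (sub_pos.mpr hrr) hs0)
    exact (((tendsto_pow_atTop_atTop_of_one_lt h1).comp
      (Filter.tendsto_add_atTop_nat 1)).const_mul_atTop
        (Real.rpow_pos_of_pos hδ (1 + s))).eventually_gt_atTop 1
  filter_upwards [hlim] with m hm
  refine iSup₂_le fun P hP => inv_mul_negLog2_le ?_
  by_contra! hlt
  set β : ℝ := 2 ^ (-(r' * ((m : ℝ) + 1))) with hβ
  have hβ0 : 0 < β := by positivity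
  set α := 1 - P.typeI (cqChannel ν) with hα
  have hα1 : 1 - ε ≤ α := by linarith
  have hα0 : 0 < α := hδ.trans_le hα1
  have h := P.rpow_mul_rpow_neg_le hs0 hs1 (by positivity) hν hμ hU hV hs (fun x => (hK x).le)
    hα hα0 hlt.le hβ0
  have e1 : α * (β / α) ^ (-s) = α ^ (1 + s) * (2 ^ (r' * s)) ^ (m + 1) := by
    rw [Real.div_rpow hβ0.le hα0.le, Real.rpow_add hα0, Real.rpow_one, Real.rpow_neg hα0.le,
      div_inv_eq_mul, hβ, ← Real.rpow_mul two_pos.le, ← Real.rpow_natCast (2 ^ (r' * s)),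
      ← Real.rpow_mul two_pos.le]
    rw [show -(r' * ((m : ℝ) + 1)) * -s = r' * s * ((m + 1 : ℕ) : ℝ) by push_cast; ring]
    ring
  have e2 : ((2 : ℝ) ^ (r' * s)) = 2 ^ ((r' - r) * s) * 2 ^ (r * s) := by
    rw [← Real.rpow_add two_pos]
    ring_nf
  have h3 : (1 - ε) ^ (1 + s) ≤ α ^ (1 + s) := Real.rpow_le_rpow hδ.le hα1 (by positivity)
  rw [e1, e2, mul_pow, ← mul_assoc] at h
  have hp : (0 : ℝ) < (2 ^ (r * s)) ^ (m + 1) := by positivity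
  have h4 : α ^ (1 + s) * (2 ^ ((r' - r) * s)) ^ (m + 1) ≤ 1 := by
    rwa [← le_div_iff₀ hp, div_self hp.ne'] at h
  exact absurd (hm.trans_le ((mul_le_mul_of_nonneg_right h3 (by positivity)).trans h4))
    (lt_irrefl _)

end Evolution

end StrongConverse

/-- Stein's lemma for classical-quantum channels:
`lim_{ε→0⁺} lim_{n→∞} ζ_n(ε, N, M) = max_x D(ν^x‖μ^x)`, with both limits existing. -/
theorem cq_stein_lemma
    {X B : Type} [Fintype X] [DecidableEq X] [Nonempty X] [Fintype B] [DecidableEq B]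
    (ν μ : X → Matrix B B ℂ) (hν : ∀ x, IsDensity (ν x)) (hμ : ∀ x, IsDensity (μ x)) :
    ∃ f : ℝ → EReal,
      (∀ ε : ℝ, 0 < ε → ε < 1 →
        Filter.Tendsto (fun m : ℕ => steinExp (cqChannel ν) (cqChannel μ) m ε)
          Filter.atTop (nhds (f ε))) ∧
      Filter.Tendsto f (nhdsWithin 0 (Set.Ioi 0)) (nhds (⨆ x, relEnt (ν x) (μ x))) := by
  refine ⟨fun _ => ⨆ x, relEnt (ν x) (μ x), fun ε hε0 hε1 => ?_, tendsto_const_nhds⟩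
  refine tendsto_order.mpr ⟨fun c hc => ?_, fun c hc => ?_⟩
  · obtain ⟨x, hx⟩ := lt_iSup_iff.mp hc
    obtain ⟨r, hcr, hr⟩ := EReal.lt_iff_exists_real_btwn.mp hx
    filter_upwards [eventually_le_steinExp hν hμ hε0 hr] with m hm
    exact hcr.trans_le hm
  · obtain ⟨r, hr, hrc⟩ := EReal.lt_iff_exists_real_btwn.mp hc
    obtain ⟨r', hrr, hrc'⟩ := EReal.lt_iff_exists_real_btwn.mp hrc
    filter_upwards [eventually_steinExp_le hν hμ hε1
      (fun x => (le_iSup (fun x => relEnt (ν x) (μ x)) x).trans_lt hr)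
      (EReal.coe_lt_coe_iff.mp hrr)] with m hm
    exact hm.trans_lt hrc'

end
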